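/- Let ((Φ^{(i)})_{i∈I}, (p_i)_{i∈I}, ℙ) be a non-trivial Bernoulli model satisfying the strong separation condition. Then there exists a Borel probability measure Q on 𝒫([-1,1]) such that: (a) Q is S-invariant, i.e. (S_t)_*Q = Q for all t ≥ 0; (b) Q is S-ergodic, i.e. every Borel set A ⊆ 𝒫([-1,1]) with S_t^{-1}A = A (up to Q-null sets) for all t ≥ 0 satisfies Q(A) ∈ {0,1}; (c) Q is non-trivial, i.e. Q is not the point mass at the Dirac measure δ_0 ∈ 𝒫([-1,1]); and (d) for ℙ-almost every ω the measure η^{(ω)} generates Q, i.e. for η^{(ω)}-almost every x and every continuous f : 𝒫([-1,1]) → ℝ, (1/T)·∫_0^T f(S_t (η^{(ω)})_x) dt → ∫ f dQ as T → ∞. -/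

import Mathlib

open MeasureTheory Filter Topology

noncomputable section

/-- The left shift on sequences. -/
def shiftSeq {I : Type*} (ω : ℕ → I) : ℕ → I := fun n => ω (n + 1)

/-- The coding map `Π_ω(u) = Σ_{n} (Π_{j<n} r_{ω_j}) · t^{(ω_n)}_{u_n}` of a model. -/
def coding {I : Type*} (k : I → ℕ) (r : I → ℝ) (t : (i : I) → Fin (k i) → ℝ)
    (ω : ℕ → I) (u : (n : ℕ) → Fin (k (ω n))) : ℝ :=
  ∑' n : ℕ, (∏ j ∈ Finset.range n, r (ω j)) * t (ω n) (u n)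

/-- The set `Y^{(ω)}`, the image of the coding map. -/
def Yset {I : Type*} (k : I → ℕ) (r : I → ℝ) (t : (i : I) → Fin (k i) → ℝ)
    (ω : ℕ → I) : Set ℝ :=
  Set.range (coding k r t ω)

/-- The measure `η^{(ω)} = (Π_ω)₌ η̄^{(ω)}`. -/
def etaMeas {I : Type*} (k : I → ℕ) (r : I → ℝ) (t : (i : I) → Fin (k i) → ℝ)
    (η' : (ω : ℕ → I) → Measure ((n : ℕ) → Fin (k (ω n)))) (ω : ℕ → I) : Measure ℝ :=
  Measure.map (coding k r t ω) (η' ω)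

/-- The recentering of a measure `η` at `x`: `η_x(E) = η(E + x) / η([x-1,x+1])` for Borel
`E ⊆ [-1,1]` (realized as a measure on `ℝ` supported on `[-1,1]`). -/
def recenter (η : Measure ℝ) (x : ℝ) : Measure ℝ :=
  (η (Set.Icc (x - 1) (x + 1)))⁻¹ •
    (Measure.map (fun y => y - x) η).restrict (Set.Icc (-1 : ℝ) 1)

/-- The scaling flow: `S_τ ν (E) = ν(e^{-τ}·E) / ν([-e^{-τ}, e^{-τ}])` for Borel
`E ⊆ [-1,1]` (realized as a measure on `ℝ` supported on `[-1,1]`). -/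
def scaleM (τ : ℝ) (ν : Measure ℝ) : Measure ℝ :=
  (ν (Set.Icc (-(Real.exp (-τ))) (Real.exp (-τ))))⁻¹ •
    (Measure.map (fun y => Real.exp τ * y) ν).restrict (Set.Icc (-1 : ℝ) 1)

open Classical in
/-- Package a measure on `ℝ` as a probability measure (with an irrelevant junk value when
it is not a probability measure). -/
def toProb (ν : Measure ℝ) : ProbabilityMeasure ℝ :=
  if h : IsProbabilityMeasure ν then ⟨ν, h⟩ else ⟨Measure.dirac 0, by infer_instance⟩

/-- Borel structure on the space of probability measures with its weak topology. -/
instance : MeasurableSpace (ProbabilityMeasure ℝ) := borel (ProbabilityMeasure ℝ)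

instance : BorelSpace (ProbabilityMeasure ℝ) := ⟨rfl⟩

/-- The scaling flow on probability measures. -/
def scaleFlow (τ : ℝ) (ν : ProbabilityMeasure ℝ) : ProbabilityMeasure ℝ :=
  toProb (scaleM τ (ν : Measure ℝ))

/-- The running maxima `max_{k ≤ n} S_k f` of the Birkhoff sums of `f`. -/
def birkhoffMax {Z : Type*} (T : Z → Z) (f : Z → ℝ) : ℕ → Z → ℝ
  | 0 => fun _ => 0
  | n + 1 => fun z => max 0 (f z + birkhoffMax T f n (T z))

section Birkhoff

variable {Z : Type*} {T : Z → Z} {f : Z → ℝ}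

lemma birkhoffMax_nonneg (n : ℕ) (z : Z) : 0 ≤ birkhoffMax T f n z := by
  cases n with
  | zero => exact le_rfl
  | succ n => exact le_max_left _ _

lemma birkhoffMax_le_succ (n : ℕ) (z : Z) :
    birkhoffMax T f n z ≤ birkhoffMax T f (n + 1) z := by
  induction n generalizing z with
  | zero => exact birkhoffMax_nonneg _ _
  | succ n ih => exact max_le_max le_rfl (by linarith [ih (T z)])

lemma birkhoffMax_mono (z : Z) : Monotone fun n => birkhoffMax T f n z :=
  monotone_nat_of_le_succ fun n => birkhoffMax_le_succ n z

lemma birkhoffSum_le_birkhoffMax (n : ℕ) (z : Z) :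
    birkhoffSum T f n z ≤ birkhoffMax T f n z := by
  induction n generalizing z with
  | zero => simp [birkhoffMax]
  | succ n ih =>
    rw [birkhoffSum_succ']
    exact le_max_of_le_right (by linarith [ih (T z)])

lemma birkhoffMax_le {M : ℝ} (hM : ∀ z, |f z| ≤ M) (n : ℕ) (z : Z) :
    birkhoffMax T f n z ≤ n * M := by
  have hM0 : 0 ≤ M := (abs_nonneg _).trans (hM z)
  induction n generalizing z with
  | zero => simp [birkhoffMax]
  | succ n ih =>
    refine max_le (by positivity) ?_
    have := ih (T z)
    have := (abs_le.1 (hM z)).2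
    push_cast
    linarith

variable [MeasurableSpace Z] {m : Measure Z} [IsProbabilityMeasure m]

lemma measurable_birkhoffMax (hT : Measurable T) (hf : Measurable f) (n : ℕ) :
    Measurable (birkhoffMax T f n) := by
  induction n with
  | zero => exact measurable_const
  | succ n ih => exact measurable_const.max (hf.add (ih.comp hT))

lemma integrable_of_abs_le {X : Type*} [MeasurableSpace X] {μ : Measure X} [IsFiniteMeasure μ]
    {g : X → ℝ} (hg : Measurable g) {M : ℝ} (hM : ∀ x, |g x| ≤ M) : Integrable g μ :=
  Integrable.of_bound hg.aestronglyMeasurable M (Eventually.of_forall hM)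

/-- If a bounded observable has negative mean under an ergodic map, then almost every sequence of
Birkhoff sums is bounded above. -/
lemma Ergodic.ae_bddAbove_birkhoffSum (hT : Ergodic T m) (hf : Measurable f) {M : ℝ}
    (hM : ∀ z, |f z| ≤ M) (hneg : ∫ z, f z ∂m < 0) :
    ∀ᵐ z ∂m, BddAbove (Set.range fun n => birkhoffSum T f n z) := by
  have hTm := hT.toMeasurePreserving.measurable
  set D : Set Z := {z | BddAbove (Set.range fun n => birkhoffSum T f n z)} with hD
  have hmS : ∀ n, Measurable (birkhoffSum T f n) := by
    intro n
    induction n with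
    | zero => exact measurable_const
    | succ n ih =>
      have : birkhoffSum T f (n + 1) = fun z => f z + birkhoffSum T f n (T z) := by
        ext z; rw [birkhoffSum_succ']
      rw [this]
      exact hf.add (ih.comp hTm)
  have hDm : MeasurableSet D := measurableSet_bddAbove_range hmS
  have hDinv : T ⁻¹' D = D := by
    ext z
    simp only [hD, Set.mem_preimage, Set.mem_ofPred_eq]
    constructor
    · rintro ⟨K, hK⟩
      refine ⟨max 0 (f z + K), ?_⟩
      rintro _ ⟨n, rfl⟩
      cases n with
      | zero => simp
      | succ n =>
        have := hK ⟨n, rfl⟩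
        simp only at this ⊢
        rw [birkhoffSum_succ']
        exact le_max_of_le_right (by linarith)
    · rintro ⟨K, hK⟩
      refine ⟨K - f z, ?_⟩
      rintro _ ⟨n, rfl⟩
      have := hK ⟨n + 1, rfl⟩
      simp only at this ⊢
      rw [birkhoffSum_succ'] at this
      linarith
  rcases hT.toPreErgodic.ae_empty_or_univ hDm hDinv with h0 | h1
  · exfalso
    have hae : ∀ᵐ z ∂m, ¬ BddAbove (Set.range fun n => birkhoffSum T f n z) := by
      exact measure_eq_zero_iff_ae_notMem.1 (ae_eq_empty.1 h0)
    have hint : ∀ n, Integrable (birkhoffMax T f n) m := fun n =>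
      integrable_of_abs_le (measurable_birkhoffMax hTm hf n) (M := n * M) fun z => by
        rw [abs_of_nonneg (birkhoffMax_nonneg n z)]
        exact birkhoffMax_le hM n z
    have hnn : ∀ n, 0 ≤ ∫ z, max (-birkhoffMax T f n (T z)) (f z) ∂m := by
      intro n
      have e : ∀ z, max (-birkhoffMax T f n (T z)) (f z)
          = birkhoffMax T f (n + 1) z - birkhoffMax T f n (T z) := by
        intro z
        simp only [birkhoffMax]
        rw [max_sub_sub_right 0 _ _ |>.symm]
        ring_nf
      simp_rw [e]
      have hi : Integrable (fun z => birkhoffMax T f n (T z)) m :=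
        hT.toMeasurePreserving.integrable_comp_of_integrable (hint n)
      rw [integral_sub (hint _) hi]
      have : ∫ z, birkhoffMax T f n (T z) ∂m = ∫ z, birkhoffMax T f n z ∂m := by
        conv_rhs => rw [← hT.toMeasurePreserving.map_eq]
        rw [integral_map hTm.aemeasurable]
        exact (measurable_birkhoffMax hTm hf n).aestronglyMeasurable
      rw [this, sub_nonneg]
      exact integral_mono (hint n) (hint (n + 1)) fun z => birkhoffMax_le_succ n z
    have hlim : Tendsto (fun n => ∫ z, max (-birkhoffMax T f n (T z)) (f z) ∂m) atTop
        (𝓝 (∫ z, f z ∂m)) := by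
      refine tendsto_integral_of_dominated_convergence (fun _ => M) (fun n => ?_)
        (integrable_const M) (fun n => Eventually.of_forall fun z => ?_) ?_
      · exact (((measurable_birkhoffMax hTm hf n).comp hTm).neg.max hf).aestronglyMeasurable
      · have h1 := abs_le.1 (hM z)
        have h2 := birkhoffMax_nonneg (T := T) (f := f) n (T z)
        rw [Real.norm_eq_abs, abs_le]
        exact ⟨le_max_of_le_right h1.1, max_le (by linarith [(abs_nonneg _).trans (hM z)]) h1.2⟩
      · filter_upwards [hae] with z hz
        apply tendsto_const_nhds.congr'
        have hz' : ¬ BddAbove (Set.range fun n => birkhoffSum T f n (T z)) := fun h => by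
          have h' : z ∈ T ⁻¹' D := h
          rw [hDinv] at h'
          exact hz h'
        rw [not_bddAbove_iff] at hz'
        obtain ⟨_, ⟨N, rfl⟩, hN⟩ := hz' M
        filter_upwards [eventually_ge_atTop N] with n hn
        have h1 := birkhoffSum_le_birkhoffMax (T := T) (f := f) N (T z)
        have h2 := birkhoffMax_mono (T := T) (f := f) (T z) hn
        have h3 := abs_le.1 (hM z)
        simp only at hN h2
        rw [max_eq_right]
        linarith
    exact absurd (ge_of_tendsto' hlim hnn) (not_le.2 hneg)
  · exact eventuallyEq_univ.1 h1

/-- A quantitative form of the pointwise ergodic theorem for bounded observables of mean zero. -/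
lemma Ergodic.ae_abs_birkhoffSum_le (hT : Ergodic T m) (hf : Measurable f) {M : ℝ}
    (hM : ∀ z, |f z| ≤ M) (h0 : ∫ z, f z ∂m = 0) :
    ∀ᵐ z ∂m, ∀ ε > 0, ∃ K, ∀ n : ℕ, |birkhoffSum T f n z| ≤ ε * n + K := by
  have key : ∀ g : Z → ℝ, Measurable g → (∀ z, |g z| ≤ M) → ∫ z, g z ∂m = 0 → ∀ ε > 0,
      ∀ᵐ z ∂m, ∃ K, ∀ n : ℕ, birkhoffSum T g n z ≤ ε * n + K := by
    intro g hg hgM hg0 ε hε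
    have hneg : ∫ z, (g z - ε) ∂m < 0 := by
      rw [integral_sub (integrable_of_abs_le hg hgM) (integrable_const _), hg0]
      simp [hε]
    filter_upwards [hT.ae_bddAbove_birkhoffSum (f := fun z => g z - ε) (hg.sub measurable_const)
      (M := M + ε) (fun z => by
        have := abs_le.1 (hgM z)
        exact abs_le.2 ⟨by linarith, by linarith⟩) hneg] with z hz
    obtain ⟨K, hK⟩ := hz
    refine ⟨K, fun n => ?_⟩
    have := hK ⟨n, rfl⟩
    simp only [birkhoffSum, Finset.sum_sub_distrib, Finset.sum_const, Finset.card_range,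
      nsmul_eq_mul] at this ⊢
    linarith
  have h1 := fun j : ℕ => key f hf hM h0 (1 / (j + 1)) Nat.one_div_pos_of_nat
  have h2 := fun j : ℕ => key (fun z => -f z) hf.neg (by simpa using hM)
    (by rw [integral_neg, h0, neg_zero]) (1 / (j + 1)) Nat.one_div_pos_of_nat
  filter_upwards [ae_all_iff.2 h1, ae_all_iff.2 h2] with z hz1 hz2 ε hε
  obtain ⟨j, hj⟩ := exists_nat_one_div_lt hε
  obtain ⟨K1, hK1⟩ := hz1 j
  obtain ⟨K2, hK2⟩ := hz2 j
  refine ⟨max K1 K2, fun n => ?_⟩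
  have a1 := hK1 n
  have a2 := hK2 n
  simp only [birkhoffSum, Finset.sum_neg_distrib] at a1 a2 ⊢
  have : (1 / ((j : ℝ) + 1)) * n ≤ ε * n := by gcongr
  rw [abs_le]
  constructor <;> linarith [le_max_left K1 K2, le_max_right K1 K2]

end Birkhoff

/-- The image under `F` of the normalised measure on the region under the graph of the roof
function `ρ`. -/
def suspMeas {Z Y : Type*} [MeasurableSpace Z] [MeasurableSpace Y] (m : Measure Z) (ρ : Z → ℝ)
    (F : Z × ℝ → Y) : Measure Y :=
  (ENNReal.ofReal (∫ z, ρ z ∂m))⁻¹ •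
    Measure.map F ((m.prod volume).restrict {x | 0 ≤ x.2 ∧ x.2 < ρ x.1})

section RealAverages

lemma intervalIntegrable_of_abs_le {g : ℝ → ℝ} (hg : Measurable g) {M : ℝ}
    (hM : ∀ t, |g t| ≤ M) (u v : ℝ) : IntervalIntegrable g volume u v :=
  (intervalIntegrable_const (c := M)).mono_fun hg.aestronglyMeasurable
    (Eventually.of_forall fun t => (hM t).trans (le_abs_self M))

/-- Shifting a bounded function does not change the limit of its averages. -/
lemma tendsto_average_shift {g : ℝ → ℝ} (hg : Measurable g) {M : ℝ} (hM : ∀ t, |g t| ≤ M)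
    {c L : ℝ}
    (h : Tendsto (fun R : ℝ => R⁻¹ * ∫ t in (0 : ℝ)..R, g t) atTop (𝓝 L)) :
    Tendsto (fun R : ℝ => R⁻¹ * ∫ t in (0 : ℝ)..R, g (t + c)) atTop (𝓝 L) := by
  have hi := intervalIntegrable_of_abs_le hg hM
  have hd : Tendsto (fun R : ℝ => R⁻¹ * ((∫ t in (0 : ℝ)..R, g (t + c)) - ∫ t in (0 : ℝ)..R, g t))
      atTop (𝓝 0) := by
    have hz : Tendsto (fun R : ℝ => R⁻¹ * (2 * (M * |c|))) atTop (𝓝 0) := by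
      simpa using tendsto_inv_atTop_zero.mul_const (2 * (M * |c|))
    refine squeeze_zero_norm' ?_ hz
    filter_upwards [eventually_gt_atTop 0] with R hR
    rw [norm_mul, norm_inv, Real.norm_eq_abs, abs_of_pos hR]
    gcongr
    rw [intervalIntegral.integral_comp_add_right, zero_add,
      ← intervalIntegral.integral_add_adjacent_intervals (hi c R) (hi R (R + c)),
      ← intervalIntegral.integral_add_adjacent_intervals (hi 0 c) (hi c R)]
    have h1 := intervalIntegral.norm_integral_le_of_norm_le_const (a := R) (b := R + c) (f := g)
      (C := M) (fun t _ => hM t)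
    have h2 := intervalIntegral.norm_integral_le_of_norm_le_const (a := 0) (b := c) (f := g)
      (C := M) (fun t _ => hM t)
    rw [add_sub_cancel_left] at h1
    rw [sub_zero] at h2
    rw [Real.norm_eq_abs] at h1 h2 ⊢
    rw [abs_le] at h1 h2 ⊢
    constructor <;> linarith
  have := h.add hd
  simp only [add_zero] at this
  refine this.congr fun R => ?_
  ring

end RealAverages

section Suspension

lemma volume_section_under_roof {Z : Type*} (ρ : Z → ℝ) (z : Z) :
    (volume {t : ℝ | (z, t) ∈ {x : Z × ℝ | 0 ≤ x.2 ∧ x.2 < ρ x.1}}) = ENNReal.ofReal (ρ z) := by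
  have : {t : ℝ | (z, t) ∈ {x : Z × ℝ | 0 ≤ x.2 ∧ x.2 < ρ x.1}} = Set.Ico 0 (ρ z) := by
    ext t; simp
  rw [this, Real.volume_Ico, sub_zero]

variable {Z Y : Type*} [MeasurableSpace Z] [MeasurableSpace Y] {m : Measure Z}
  [IsProbabilityMeasure m] {T : Z → Z} {ρ : Z → ℝ} {a b : ℝ} {F : Z × ℝ → Y}

lemma measurableSet_under_roof (hρ : Measurable ρ) :
    MeasurableSet {x : Z × ℝ | 0 ≤ x.2 ∧ x.2 < ρ x.1} :=
  (measurableSet_le measurable_const measurable_snd).inter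
    (measurableSet_lt measurable_snd (hρ.comp measurable_fst))

lemma integrable_roof (hρ : Measurable ρ) (ha : 0 < a) (hρa : ∀ z, a ≤ ρ z)
    (hρb : ∀ z, ρ z ≤ b) : Integrable ρ m :=
  integrable_of_abs_le hρ (M := b) fun z => by
    rw [abs_of_pos (ha.trans_le (hρa z))]; exact hρb z

lemma integral_roof_pos (hρ : Measurable ρ) (ha : 0 < a) (hρa : ∀ z, a ≤ ρ z)
    (hρb : ∀ z, ρ z ≤ b) : 0 < ∫ z, ρ z ∂m := by
  have : ∫ _, a ∂m ≤ ∫ z, ρ z ∂m :=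
    integral_mono (integrable_const a) (integrable_roof hρ ha hρa hρb) hρa
  simp at this
  linarith

lemma measure_under_roof (hρ : Measurable ρ) (ha : 0 < a) (hρa : ∀ z, a ≤ ρ z)
    (hρb : ∀ z, ρ z ≤ b) :
    (m.prod volume) {x : Z × ℝ | 0 ≤ x.2 ∧ x.2 < ρ x.1} = ENNReal.ofReal (∫ z, ρ z ∂m) := by
  rw [Measure.prod_apply (measurableSet_under_roof hρ)]
  have : ∀ z, volume (Prod.mk z ⁻¹' {x : Z × ℝ | 0 ≤ x.2 ∧ x.2 < ρ x.1})
      = ENNReal.ofReal (ρ z) := volume_section_under_roof ρ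
  simp_rw [this]
  rw [ofReal_integral_eq_lintegral_ofReal (integrable_roof hρ ha hρa hρb)
    (Eventually.of_forall fun z => (ha.trans_le (hρa z)).le)]

lemma isProbabilityMeasure_suspMeas (hρ : Measurable ρ) (ha : 0 < a) (hρa : ∀ z, a ≤ ρ z)
    (hρb : ∀ z, ρ z ≤ b) (hF : Measurable F) : IsProbabilityMeasure (suspMeas m ρ F) := by
  constructor
  rw [suspMeas, Measure.smul_apply, Measure.map_apply hF MeasurableSet.univ, Set.preimage_univ,
    Measure.restrict_apply_univ, measure_under_roof hρ ha hρa hρb, smul_eq_mul,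
    ENNReal.inv_mul_cancel]
  · simpa using integral_roof_pos (m := m) hρ ha hρa hρb
  · exact ENNReal.ofReal_ne_top

omit [IsProbabilityMeasure m] in
/-- A property that holds `suspMeas`-almost surely holds along almost all flow lines below the
roof. -/
lemma ae_under_roof_of_ae_suspMeas (hF : Measurable F) {p : Y → Prop}
    (h : ∀ᵐ y ∂(suspMeas m ρ F), p y) :
    ∀ᵐ x ∂((m.prod volume).restrict {x : Z × ℝ | 0 ≤ x.2 ∧ x.2 < ρ x.1}), p (F x) := by
  rw [suspMeas] at h
  have h' : ∀ᵐ y ∂(Measure.map F ((m.prod volume).restrict {x | 0 ≤ x.2 ∧ x.2 < ρ x.1})), p y := by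
    rw [ae_iff] at h ⊢
    rw [Measure.smul_apply, smul_eq_mul, mul_eq_zero] at h
    exact h.resolve_left (by simp)
  exact ae_of_ae_map hF.aemeasurable h'

lemma measurable_integral_under_roof (hρ : Measurable ρ) (ha : 0 < a) (hρa : ∀ z, a ≤ ρ z)
    {g : Z × ℝ → ℝ} (hg : Measurable g) :
    Measurable fun z => ∫ t in (0 : ℝ)..ρ z, g (z, t) := by
  have e : ∀ z, ∫ t in (0 : ℝ)..ρ z, g (z, t)
      = ∫ t, (Set.indicator {x : Z × ℝ | 0 < x.2 ∧ x.2 ≤ ρ x.1} g) (z, t) := by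
    intro z
    rw [intervalIntegral.integral_of_le (ha.le.trans (hρa z)),
      ← integral_indicator measurableSet_Ioc]
    rfl
  simp_rw [e]
  have : MeasurableSet {x : Z × ℝ | 0 < x.2 ∧ x.2 ≤ ρ x.1} :=
    (measurableSet_lt measurable_const measurable_snd).inter
    (measurableSet_le measurable_snd (hρ.comp measurable_fst))
  exact (StronglyMeasurable.integral_prod_right (f := fun z t => (Set.indicator
    {x : Z × ℝ | 0 < x.2 ∧ x.2 ≤ ρ x.1} g) (z, t))
    (hg.indicator this).stronglyMeasurable).measurable

lemma integral_suspMeas (hρ : Measurable ρ) (ha : 0 < a) (hρa : ∀ z, a ≤ ρ z)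
    (hρb : ∀ z, ρ z ≤ b) (hF : Measurable F) {h : Y → ℝ} (hh : Measurable h) {M : ℝ}
    (hM : ∀ y, |h y| ≤ M) :
    ∫ y, h y ∂(suspMeas m ρ F)
      = (∫ z, ρ z ∂m)⁻¹ * ∫ z, (∫ t in (0 : ℝ)..ρ z, h (F (z, t))) ∂m := by
  have hc := integral_roof_pos (m := m) hρ ha hρa hρb
  have hU := measurableSet_under_roof hρ
  have hfin : IsFiniteMeasure ((m.prod volume).restrict {x : Z × ℝ | 0 ≤ x.2 ∧ x.2 < ρ x.1}) :=
    ⟨by rw [Measure.restrict_apply_univ, measure_under_roof hρ ha hρa hρb]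
        exact ENNReal.ofReal_lt_top⟩
  rw [suspMeas, integral_smul_measure, integral_map hF.aemeasurable hh.aestronglyMeasurable,
    ENNReal.toReal_inv, ENNReal.toReal_ofReal hc.le, smul_eq_mul, ← integral_indicator hU]
  congr 1
  rw [integral_prod]
  · refine integral_congr_ae (Eventually.of_forall fun z => ?_)
    simp only
    rw [intervalIntegral.integral_of_le (ha.le.trans (hρa z)), ← integral_Ico_eq_integral_Ioc,
      ← integral_indicator measurableSet_Ico]
    rfl
  · rw [integrable_indicator_iff hU]
    exact integrable_of_abs_le (hh.comp hF) (M := M) fun x => hM _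

lemma integral_shift_suspMeas (hT : MeasurePreserving T m m) (hρ : Measurable ρ) (ha : 0 < a)
    (hρa : ∀ z, a ≤ ρ z) (hF : Measurable F)
    (hFT : ∀ᵐ z ∂m, ∀ t, 0 ≤ t → F (z, ρ z + t) = F (T z, t))
    {h : Y → ℝ} (hh : Measurable h) {M : ℝ} (hM : ∀ y, |h y| ≤ M) (hρb : ∀ z, ρ z ≤ b)
    {τ : ℝ} (hτ : 0 ≤ τ) :
    ∫ z, (∫ t in (0 : ℝ)..ρ z, h (F (z, t + τ))) ∂m
      = ∫ z, (∫ t in (0 : ℝ)..ρ z, h (F (z, t))) ∂m := by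
  have hM0 : ∀ t : Z × ℝ, |h (F t)| ≤ M := fun _ => hM _
  have hhF : Measurable fun x : Z × ℝ => h (F x) := hh.comp hF
  have hsec : ∀ z, Measurable fun t => h (F (z, t)) := fun z => hhF.comp measurable_prodMk_left
  have hbd : ∀ (z : Z) (u v : ℝ), |∫ t in u..v, h (F (z, t))| ≤ M * |v - u| := fun z u v =>
    intervalIntegral.norm_integral_le_of_norm_le_const (f := fun t => h (F (z, t))) fun t _ => hM _
  set G : Z → ℝ := fun z => ∫ t in (0 : ℝ)..τ, h (F (z, t)) with hG
  have hGm : Measurable G := by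
    have e : ∀ z, G z = ∫ t, h (F (z, t)) ∂(volume.restrict (Set.Ioc 0 τ)) := fun z =>
      intervalIntegral.integral_of_le hτ
    rw [funext e]
    exact (StronglyMeasurable.integral_prod_right (f := fun z t => h (F (z, t)))
      hhF.stronglyMeasurable).measurable
  have hGi : Integrable G m := integrable_of_abs_le hGm fun z => hbd z 0 τ
  have hHm := measurable_integral_under_roof hρ ha hρa hhF
  have hMnn : ∀ z : Z, 0 ≤ M := fun z => (abs_nonneg _).trans (hM (F (z, 0)))
  have hHi : Integrable (fun z => ∫ t in (0 : ℝ)..ρ z, h (F (z, t))) m :=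
    integrable_of_abs_le hHm (M := M * b) fun z => by
      refine (hbd z 0 (ρ z)).trans ?_
      rw [sub_zero, abs_of_pos (ha.trans_le (hρa z))]
      exact mul_le_mul_of_nonneg_left (hρb z) (hMnn z)
  have hGT : ∫ z, G (T z) ∂m = ∫ z, G z ∂m := by
    conv_rhs => rw [← hT.map_eq]
    rw [integral_map hT.measurable.aemeasurable hGm.aestronglyMeasurable]
  have hGTi : Integrable (fun z => G (T z)) m := hT.integrable_comp_of_integrable hGi
  have key : ∀ᵐ z ∂m, ∫ t in (0 : ℝ)..ρ z, h (F (z, t + τ))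
      = (∫ t in (0 : ℝ)..ρ z, h (F (z, t))) + G (T z) - G z := by
    filter_upwards [hFT] with z hz
    have hi := intervalIntegrable_of_abs_le (hsec z) (fun t => hM0 _)
    have e1 : G (T z) = ∫ t in (ρ z)..(ρ z + τ), h (F (z, t)) := by
      have : ∫ t in (ρ z)..(ρ z + τ), h (F (z, t)) = ∫ t in (0 : ℝ)..τ, h (F (z, ρ z + t)) := by
        rw [intervalIntegral.integral_comp_add_left (fun t => h (F (z, t))), add_zero]
      rw [this]
      refine intervalIntegral.integral_congr fun t ht => ?_
      rw [Set.uIcc_of_le hτ] at ht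
      simp only [hz t ht.1]
    rw [intervalIntegral.integral_comp_add_right (fun t => h (F (z, t))), zero_add, e1,
      intervalIntegral.integral_add_adjacent_intervals (hi _ _) (hi _ _),
      ← intervalIntegral.integral_add_adjacent_intervals (hi 0 τ) (hi τ _)]
    simp [hG]
  have hsum : Integrable (fun z => (∫ t in (0 : ℝ)..ρ z, h (F (z, t))) + G (T z)) m :=
    hHi.add hGTi
  rw [integral_congr_ae key, integral_sub hsum hGi, integral_add hHi hGTi, hGT]
  ring

/-- The suspension measure is invariant under a flow that acts by translation in the second
variable. -/
lemma map_suspMeas (hT : MeasurePreserving T m m) (hρ : Measurable ρ) (ha : 0 < a)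
    (hρa : ∀ z, a ≤ ρ z) (hρb : ∀ z, ρ z ≤ b) (hF : Measurable F)
    (hFT : ∀ᵐ z ∂m, ∀ t, 0 ≤ t → F (z, ρ z + t) = F (T z, t))
    {S : ℝ → Y → Y} (hS : ∀ τ, Measurable (S τ))
    (hSF : ∀ᵐ z ∂m, ∀ t τ, 0 ≤ t → 0 ≤ τ → S τ (F (z, t)) = F (z, t + τ)) {τ : ℝ} (hτ : 0 ≤ τ) :
    Measure.map (S τ) (suspMeas m ρ F) = suspMeas m ρ F := by
  have := isProbabilityMeasure_suspMeas (m := m) hρ ha hρa hρb hF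
  have := Measure.isProbabilityMeasure_map (μ := suspMeas m ρ F) (hS τ).aemeasurable
  ext A hA
  rw [Measure.map_apply (hS τ) hA]
  set h : Y → ℝ := A.indicator 1 with hh
  have hhm : Measurable h := measurable_one.indicator hA
  have hM : ∀ y, |h y| ≤ 1 := fun y => by
    by_cases hy : y ∈ A <;> simp [hh, hy]
  have e1 : ∫ y, h y ∂(suspMeas m ρ F) = (suspMeas m ρ F).real A := by
    rw [hh, integral_indicator_one hA]
  have e2 : ∫ y, h (S τ y) ∂(suspMeas m ρ F) = (suspMeas m ρ F).real (S τ ⁻¹' A) := by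
    rw [← integral_indicator_one (hS τ hA)]
    rfl
  have e3 : (suspMeas m ρ F).real (S τ ⁻¹' A) = (suspMeas m ρ F).real A := by
    rw [← e1, ← e2, integral_suspMeas (h := fun y => h (S τ y)) hρ ha hρa hρb hF
        (hhm.comp (hS τ)) (fun y => hM (S τ y)),
      integral_suspMeas hρ ha hρa hρb hF hhm hM]
    congr 1
    rw [← integral_shift_suspMeas hT hρ ha hρa hF hFT hhm hM hρb hτ]
    refine integral_congr_ae ?_
    filter_upwards [hSF] with z hz
    refine intervalIntegral.integral_congr fun t ht => ?_
    rw [Set.uIcc_of_le (ha.le.trans (hρa z))] at ht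
    simp only [hz t τ ht.1 hτ]
  exact (measureReal_eq_measureReal_iff).1 e3

omit [MeasurableSpace Z] in
lemma exists_birkhoffSum_le_lt (ha : 0 < a) (hρa : ∀ z, a ≤ ρ z) (z : Z) {R : ℝ} (hR : 0 ≤ R) :
    ∃ n : ℕ, birkhoffSum T ρ n z ≤ R ∧ R < birkhoffSum T ρ (n + 1) z := by
  classical
  have hlow : ∀ n : ℕ, a * n ≤ birkhoffSum T ρ n z := fun n => by
    have : ∑ _i ∈ Finset.range n, a ≤ birkhoffSum T ρ n z := Finset.sum_le_sum fun i _ => hρa _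
    simpa [mul_comm] using this
  have hex : ∃ n : ℕ, R < birkhoffSum T ρ n z := by
    obtain ⟨n, hn⟩ := exists_nat_gt (R / a)
    exact ⟨n, lt_of_lt_of_le (by rwa [div_lt_iff₀' ha] at hn) (hlow n)⟩
  have hpos : Nat.find hex ≠ 0 := fun h0 => by
    have := Nat.find_spec hex
    rw [h0] at this
    simp at this
    linarith
  obtain ⟨n, hn⟩ := Nat.exists_eq_succ_of_ne_zero hpos
  refine ⟨n, not_lt.1 (Nat.find_min hex (by omega)), ?_⟩
  have := Nat.find_spec hex
  rwa [hn] at this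

/-- Along almost every flow line, time averages converge to the mean with respect to the suspension
measure. -/
lemma ae_tendsto_average_suspMeas (hT : Ergodic T m) (hρ : Measurable ρ) (ha : 0 < a)
    (hρa : ∀ z, a ≤ ρ z) (hρb : ∀ z, ρ z ≤ b) (hF : Measurable F)
    (hFT : ∀ᵐ z ∂m, ∀ t, 0 ≤ t → F (z, ρ z + t) = F (T z, t))
    {h : Y → ℝ} (hh : Measurable h) {M : ℝ} (hM : ∀ y, |h y| ≤ M) :
    ∀ᵐ z ∂m, Tendsto (fun R : ℝ => R⁻¹ * ∫ t in (0 : ℝ)..R, h (F (z, t))) atTop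
      (𝓝 (∫ y, h y ∂(suspMeas m ρ F))) := by
  have hQ := isProbabilityMeasure_suspMeas (m := m) hρ ha hρa hρb hF
  set L := ∫ y, h y ∂(suspMeas m ρ F) with hL
  have hLM : |L| ≤ M := by
    have := norm_integral_le_of_norm_le_const (μ := suspMeas m ρ F) (f := h) (C := M)
      (Eventually.of_forall hM)
    simpa using this
  set g : Y → ℝ := fun y => h y - L with hg
  have hgm : Measurable g := hh.sub measurable_const
  have hgM : ∀ y, |g y| ≤ 2 * M := fun y => (abs_sub _ _).trans (by linarith [hM y])
  set H : Z → ℝ := fun z => ∫ t in (0 : ℝ)..ρ z, g (F (z, t)) with hH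
  have hHm : Measurable H := measurable_integral_under_roof hρ ha hρa (hgm.comp hF)
  have hMnn : ∀ z : Z, 0 ≤ M := fun z => (abs_nonneg _).trans (hM (F (z, 0)))
  have hHb : ∀ z, |H z| ≤ 2 * M * b := fun z => by
    have := intervalIntegral.norm_integral_le_of_norm_le_const (a := 0) (b := ρ z)
      (f := fun t => g (F (z, t))) fun t _ => hgM _
    refine this.trans ?_
    rw [sub_zero, abs_of_pos (ha.trans_le (hρa z))]
    exact mul_le_mul_of_nonneg_left (hρb z) (by linarith [hMnn z])
  have hH0 : ∫ z, H z ∂m = 0 := by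
    have e := integral_suspMeas (m := m) hρ ha hρa hρb hF hgm hgM
    have e0 : ∫ y, g y ∂(suspMeas m ρ F) = 0 := by
      rw [hg, integral_sub (integrable_of_abs_le hh hM) (integrable_const _)]
      simp [hL]
    rw [e0] at e
    have := integral_roof_pos (m := m) hρ ha hρa hρb
    rcases mul_eq_zero.1 e.symm with h1 | h1
    · exact absurd h1 (inv_ne_zero this.ne')
    · exact h1
  have hiter : ∀ᵐ z ∂m, ∀ n : ℕ, ∀ t, 0 ≤ t →
      F (T^[n] z, ρ (T^[n] z) + t) = F (T (T^[n] z), t) :=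
    ae_all_iff.2 fun n =>
      (hT.toMeasurePreserving.quasiMeasurePreserving.iterate n).ae hFT
  filter_upwards [hiter, hT.ae_abs_birkhoffSum_le hHm hHb hH0] with z hz hbirk
  have hgs : Measurable fun t => g (F (z, t)) := (hgm.comp hF).comp measurable_prodMk_left
  have hgi := intervalIntegrable_of_abs_le hgs (fun t => hgM _)
  have hρn : ∀ n, 0 ≤ birkhoffSum T ρ n z := fun n =>
    Finset.sum_nonneg fun i _ => (ha.trans_le (hρa _)).le
  have hshift : ∀ n : ℕ, ∀ t, 0 ≤ t → F (z, birkhoffSum T ρ n z + t) = F (T^[n] z, t) := by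
    intro n
    induction n with
    | zero => intro t _; simp
    | succ n ih =>
      intro t ht
      rw [birkhoffSum_succ, add_assoc, ih _ (add_nonneg (ha.trans_le (hρa _)).le ht), hz n t ht,
        Function.iterate_succ_apply']
  have hsum : ∀ n : ℕ, ∫ t in (0 : ℝ)..birkhoffSum T ρ n z, g (F (z, t)) = birkhoffSum T H n z := by
    intro n
    induction n with
    | zero => simp
    | succ n ih =>
      rw [birkhoffSum_succ T H, ← ih, birkhoffSum_succ,
        ← intervalIntegral.integral_add_adjacent_intervals (hgi 0 (birkhoffSum T ρ n z)) (hgi _ _)]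
      congr 1
      have e : ∫ t in (birkhoffSum T ρ n z)..(birkhoffSum T ρ n z + ρ (T^[n] z)), g (F (z, t))
          = ∫ t in (0 : ℝ)..ρ (T^[n] z), g (F (z, birkhoffSum T ρ n z + t)) := by
        rw [intervalIntegral.integral_comp_add_left (fun t => g (F (z, t))), add_zero]
      rw [e]
      refine intervalIntegral.integral_congr fun t ht => ?_
      rw [Set.uIcc_of_le (ha.le.trans (hρa _))] at ht
      simp only [hshift n t ht.1]
  have hgrow : ∀ ε > 0, ∃ K, ∀ R, 0 ≤ R → |∫ t in (0 : ℝ)..R, g (F (z, t))| ≤ ε * R + K := by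
    intro ε hε
    obtain ⟨K, hK⟩ := hbirk (ε * a) (by positivity)
    refine ⟨K + 2 * M * b, fun R hR => ?_⟩
    obtain ⟨n, hn1, hn2⟩ := exists_birkhoffSum_le_lt (T := T) ha hρa z hR
    have hlow : a * n ≤ birkhoffSum T ρ n z := by
      have : ∑ _i ∈ Finset.range n, a ≤ birkhoffSum T ρ n z := Finset.sum_le_sum fun i _ => hρa _
      simpa [mul_comm] using this
    rw [← intervalIntegral.integral_add_adjacent_intervals (hgi 0 (birkhoffSum T ρ n z)) (hgi _ R),
      hsum]
    have h1 := intervalIntegral.norm_integral_le_of_norm_le_const (a := birkhoffSum T ρ n z)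
      (b := R) (f := fun t => g (F (z, t))) fun t _ => hgM _
    rw [Real.norm_eq_abs, abs_of_nonneg (sub_nonneg.2 hn1)] at h1
    have h2 : R - birkhoffSum T ρ n z ≤ b := by
      rw [birkhoffSum_succ] at hn2
      linarith [hρb (T^[n] z)]
    have h3 : 2 * M * (R - birkhoffSum T ρ n z) ≤ 2 * M * b :=
      mul_le_mul_of_nonneg_left h2 (by linarith [hMnn z])
    have h4 : ε * a * n ≤ ε * R := by
      rw [mul_assoc]
      exact mul_le_mul_of_nonneg_left (hlow.trans hn1) hε.le
    refine (abs_add_le _ _).trans ?_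
    linarith [hK n]
  have hlim : Tendsto (fun R : ℝ => R⁻¹ * ∫ t in (0 : ℝ)..R, g (F (z, t))) atTop (𝓝 0) := by
    rw [Metric.tendsto_atTop]
    intro ε hε
    obtain ⟨K, hK⟩ := hgrow (ε / 2) (by positivity)
    refine ⟨2 * |K| / ε + 1, fun R hR => ?_⟩
    have hRpos : 0 < R := lt_of_lt_of_le (by positivity) hR
    have h1 : 2 * |K| / ε < R := by linarith
    rw [div_lt_iff₀ hε] at h1
    rw [dist_zero_right, norm_mul, norm_inv, Real.norm_eq_abs, Real.norm_eq_abs, abs_of_pos hRpos,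
      inv_mul_lt_iff₀ hRpos]
    have := hK R hRpos.le
    linarith [le_abs_self K]
  have := hlim.add_const L
  rw [zero_add] at this
  refine this.congr' ?_
  filter_upwards [eventually_gt_atTop 0] with R hR
  have hhs : Measurable fun t => h (F (z, t)) := (hh.comp hF).comp measurable_prodMk_left
  simp only [hg]
  rw [intervalIntegral.integral_sub (intervalIntegrable_of_abs_le hhs (fun t => hM _) _ _)
    intervalIntegrable_const, intervalIntegral.integral_const, smul_eq_mul, sub_zero]
  field_simp
  ring

/-- The suspension measure is ergodic for the flow. -/
lemma suspMeas_eq_zero_or_one (hT : Ergodic T m) (hρ : Measurable ρ) (ha : 0 < a)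
    (hρa : ∀ z, a ≤ ρ z) (hρb : ∀ z, ρ z ≤ b) (hF : Measurable F)
    (hFT : ∀ᵐ z ∂m, ∀ t, 0 ≤ t → F (z, ρ z + t) = F (T z, t))
    {S : ℝ → Y → Y}
    (hSF : ∀ᵐ z ∂m, ∀ t τ, 0 ≤ t → 0 ≤ τ → S τ (F (z, t)) = F (z, t + τ))
    {A : Set Y} (hA : MeasurableSet A)
    (hinv : ∀ τ, 0 ≤ τ → suspMeas m ρ F (symmDiff A (S τ ⁻¹' A)) = 0) :
    suspMeas m ρ F A = 0 ∨ suspMeas m ρ F A = 1 := by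
  have hQ := isProbabilityMeasure_suspMeas (m := m) hρ ha hρa hρb hF
  set h : Y → ℝ := A.indicator 1 with hh
  have hhm : Measurable h := measurable_one.indicator hA
  have h01 : ∀ y, h y = 0 ∨ h y = 1 := fun y => by
    by_cases hy : y ∈ A <;> simp [hh, hy]
  have hM : ∀ y, |h y| ≤ 1 := fun y => by rcases h01 y with e | e <;> simp [e]
  have e1 : ∫ y, h y ∂(suspMeas m ρ F) = (suspMeas m ρ F).real A := by
    rw [hh, integral_indicator_one hA]
  set U : Measure (Z × ℝ) := (m.prod volume).restrict {x | 0 ≤ x.2 ∧ x.2 < ρ x.1} with hU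
  have hlift : ∀ {p : Z → Prop}, (∀ᵐ z ∂m, p z) → ∀ᵐ x ∂U, p x.1 := fun hp =>
    ae_restrict_of_ae (Measure.quasiMeasurePreserving_fst.ae hp)
  have hmem : ∀ᵐ x ∂U, 0 ≤ x.2 ∧ x.2 < ρ x.1 := ae_restrict_mem (measurableSet_under_roof hρ)
  have hstep : ∀ᵐ τ ∂(volume.restrict (Set.Ici (0 : ℝ))), ∀ᵐ x ∂U,
      h (F (x.1, x.2 + τ)) = h (F x) := by
    filter_upwards [ae_restrict_mem measurableSet_Ici] with τ hτ
    have h0 : ∀ᵐ y ∂(suspMeas m ρ F), h (S τ y) = h y := by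
      have := measure_eq_zero_iff_ae_notMem.1 (hinv τ hτ)
      filter_upwards [this] with y hy
      rw [Set.mem_symmDiff] at hy
      by_cases hy1 : y ∈ A <;> by_cases hy2 : S τ y ∈ A <;> simp [hh, hy1, hy2] <;> simp_all
    filter_upwards [ae_under_roof_of_ae_suspMeas hF h0, hlift hSF, hmem] with x hx1 hx2 hx3
    rw [← hx1, ← hx2 x.2 τ hx3.1 hτ]
  have hswap : ∀ᵐ x ∂U, ∀ᵐ τ ∂(volume.restrict (Set.Ici (0 : ℝ))),
      h (F (x.1, x.2 + τ)) = h (F x) := by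
    rw [Measure.ae_ae_comm]
    · exact hstep
    · refine measurableSet_eq_fun ?_ ?_
      · exact hhm.comp (hF.comp ((measurable_fst.comp measurable_fst).prodMk
          ((measurable_snd.comp measurable_fst).add measurable_snd)))
      · exact hhm.comp (hF.comp measurable_fst)
  have hconst : ∀ᵐ x ∂U, h (F x) = (suspMeas m ρ F).real A := by
    filter_upwards [hswap, hlift (ae_tendsto_average_suspMeas hT hρ ha hρa hρb hF hFT hhm hM)]
      with x hx hlim
    have hhs : Measurable fun t => h (F (x.1, t)) := (hhm.comp hF).comp measurable_prodMk_left
    have hl := tendsto_average_shift hhs (fun t => hM _) (c := x.2) hlim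
    rw [e1] at hl
    refine tendsto_nhds_unique (tendsto_const_nhds.congr' ?_) hl
    filter_upwards [eventually_gt_atTop 0] with R hR
    have : ∫ t in (0 : ℝ)..R, h (F (x.1, t + x.2)) = ∫ t in (0 : ℝ)..R, h (F x) := by
      refine intervalIntegral.integral_congr_ae ?_
      rw [ae_restrict_iff' measurableSet_Ici] at hx
      filter_upwards [hx] with t ht hmem
      rw [Set.uIoc_of_le hR.le] at hmem
      rw [add_comm t]
      exact ht hmem.1.le
    rw [this, intervalIntegral.integral_const, smul_eq_mul, sub_zero]
    field_simp
  have hne : NeZero U := ⟨fun h0 => by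
    have := measure_under_roof (m := m) hρ ha hρa hρb
    rw [← Measure.restrict_apply_univ, ← hU, h0] at this
    have hp := integral_roof_pos (m := m) hρ ha hρa hρb
    simp at this
    linarith⟩
  obtain ⟨x, hx⟩ := hconst.exists
  have hr : (suspMeas m ρ F).real A = 0 ∨ (suspMeas m ρ F).real A = 1 := by
    rw [← hx]; exact h01 _
  rcases hr with hr | hr
  · left
    simpa [measureReal_def, ENNReal.toReal_eq_zero_iff] using hr
  · right
    simpa [measureReal_def, ENNReal.toReal_eq_one_iff] using hr

end Suspension

/-- The cylinder of all sequences that agree with `c` in the first `n` places. -/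
def seqCylinder {A : Type*} (n : ℕ) (c : ℕ → A) : Set (ℕ → A) := {x | ∀ j < n, x j = c j}

/-- The family of all cylinders. -/
def seqCylinders (A : Type*) : Set (Set (ℕ → A)) := {s | ∃ n c, s = seqCylinder n c}

section Cylinders

variable {A : Type*} [MeasurableSpace A] [MeasurableSingletonClass A]

omit [MeasurableSpace A] [MeasurableSingletonClass A] in
@[simp] lemma seqCylinder_zero (c : ℕ → A) : seqCylinder 0 c = Set.univ := by
  ext x; simp [seqCylinder]

omit [MeasurableSpace A] [MeasurableSingletonClass A] in
lemma seqCylinder_succ (n : ℕ) (c : ℕ → A) :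
    seqCylinder (n + 1) c = {x | x 0 = c 0} ∩ shiftSeq ⁻¹' (seqCylinder n (shiftSeq c)) := by
  ext x
  simp only [seqCylinder, shiftSeq, Set.mem_inter_iff, Set.mem_preimage, Set.mem_ofPred_eq]
  constructor
  · exact fun h => ⟨h 0 (by omega), fun j hj => h (j + 1) (by omega)⟩
  · rintro ⟨h0, h⟩ j hj
    cases j with
    | zero => exact h0
    | succ j => exact h j (by omega)

omit [MeasurableSingletonClass A] in
lemma measurable_shiftSeq : Measurable (shiftSeq : (ℕ → A) → ℕ → A) :=
  measurable_pi_lambda _ fun n => measurable_pi_apply (n + 1)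

lemma measurableSet_coord_eq (j : ℕ) (a : A) : MeasurableSet {x : ℕ → A | x j = a} :=
  measurable_pi_apply (X := fun _ => A) j (measurableSet_singleton a)

lemma measurableSet_seqCylinder (n : ℕ) (c : ℕ → A) : MeasurableSet (seqCylinder n c) := by
  have : seqCylinder n c = ⋂ j ∈ Set.Iio n, {x : ℕ → A | x j = c j} := by
    ext x; simp [seqCylinder]
  rw [this]
  exact MeasurableSet.biInter (Set.to_countable _) fun j _ => measurableSet_coord_eq j (c j)

omit [MeasurableSpace A] [MeasurableSingletonClass A] in
lemma isPiSystem_seqCylinders : IsPiSystem (seqCylinders A) := by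
  rintro _ ⟨n, c, rfl⟩ _ ⟨l, d, rfl⟩ ⟨x, hx1, hx2⟩
  refine ⟨max n l, x, ?_⟩
  ext y
  simp only [seqCylinder, Set.mem_inter_iff, Set.mem_ofPred_eq] at hx1 hx2 ⊢
  constructor
  · rintro ⟨h1, h2⟩ j hj
    rcases lt_max_iff.1 hj with h | h
    · rw [h1 j h, hx1 j h]
    · rw [h2 j h, hx2 j h]
  · intro h
    exact ⟨fun j hj => by rw [h j (lt_max_of_lt_left hj), hx1 j hj],
      fun j hj => by rw [h j (lt_max_of_lt_right hj), hx2 j hj]⟩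

lemma generateFrom_seqCylinders [Countable A] [Nonempty A] :
    (MeasurableSpace.pi : MeasurableSpace (ℕ → A))
      = MeasurableSpace.generateFrom (seqCylinders A) := by
  apply le_antisymm
  · refine iSup_le fun n => ?_
    rw [MeasurableSpace.comap_le_iff_le_map]
    intro s _
    change MeasurableSet[MeasurableSpace.generateFrom (seqCylinders A)] ((fun x : ℕ → A => x n) ⁻¹' s)
    classical
    let e : (Fin (n + 1) → A) → ℕ → A := fun c j =>
      if h : j < n + 1 then c ⟨j, h⟩ else Classical.arbitrary A
    have : (fun x : ℕ → A => x n) ⁻¹' s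
        = ⋃ c : {c : Fin (n + 1) → A // c (Fin.last n) ∈ s}, seqCylinder (n + 1) (e c) := by
      ext x
      simp only [Set.mem_preimage, Set.mem_iUnion, seqCylinder, Set.mem_ofPred_eq]
      constructor
      · intro hx
        refine ⟨⟨fun j => x j, hx⟩, fun j hj => ?_⟩
        simp only [e, dif_pos hj]
      · rintro ⟨⟨c, hc⟩, h⟩
        rw [h n (by omega)]
        simp only [e, dif_pos (Nat.lt_succ_self n)]
        exact hc
    rw [this]
    exact MeasurableSet.iUnion fun c => MeasurableSpace.measurableSet_generateFrom ⟨_, _, rfl⟩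
  · refine MeasurableSpace.generateFrom_le ?_
    rintro _ ⟨n, c, rfl⟩
    exact measurableSet_seqCylinder n c

lemma Measure.ext_of_seqCylinder [Countable A] [Nonempty A] {μ ν : Measure (ℕ → A)}
    [IsFiniteMeasure μ] (h : ∀ n c, μ (seqCylinder n c) = ν (seqCylinder n c)) : μ = ν := by
  refine ext_of_generate_finite _ generateFrom_seqCylinders isPiSystem_seqCylinders ?_ ?_
  · rintro _ ⟨n, c, rfl⟩
    exact h n c
  · simpa using h 0 (Classical.arbitrary _)

lemma measurable_measure_of_seqCylinder [Countable A] [Nonempty A] {Ω : Type*}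
    [MeasurableSpace Ω] {κ : Ω → Measure (ℕ → A)} [∀ ω, IsProbabilityMeasure (κ ω)]
    (h : ∀ n c, Measurable fun ω => κ ω (seqCylinder n c)) : Measurable κ := by
  refine Measurable.measure_of_isPiSystem_of_isProbabilityMeasure generateFrom_seqCylinders
    isPiSystem_seqCylinders ?_
  rintro _ ⟨n, c, rfl⟩
  exact h n c

/-- To describe the part of `ν` that sits on the sequences starting with `a`, it is enough to know
its mass on cylinders. -/
lemma measure_first_inter_shift [Countable A] [Nonempty A] {ν ν' : Measure (ℕ → A)}
    [IsFiniteMeasure ν] {a : A} {w : ENNReal}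
    (h : ∀ n c, ν ({x | x 0 = a} ∩ shiftSeq ⁻¹' (seqCylinder n c)) = w * ν' (seqCylinder n c))
    {E : Set (ℕ → A)} (hE : MeasurableSet E) :
    ν ({x | x 0 = a} ∩ shiftSeq ⁻¹' E) = w * ν' E := by
  have e : Measure.map shiftSeq (ν.restrict {x | x 0 = a}) = w • ν' := by
    refine Measure.ext_of_seqCylinder fun n c => ?_
    rw [Measure.map_apply measurable_shiftSeq (measurableSet_seqCylinder n c),
      Measure.restrict_apply (measurable_shiftSeq (measurableSet_seqCylinder n c)), Set.inter_comm,
      h, Measure.smul_apply, smul_eq_mul]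
  have := congrArg (fun m : Measure (ℕ → A) => m E) e
  simp only [Measure.smul_apply, smul_eq_mul] at this
  rw [← this, Measure.map_apply measurable_shiftSeq hE,
    Measure.restrict_apply (measurable_shiftSeq hE), Set.inter_comm]

end Cylinders

/-- The skew product over the shift with multiplicative cocycle `φ (x 0)`. -/
def skewShift {A : Type*} (φ : A → ℝ) (z : (ℕ → A) × ℝ) : (ℕ → A) × ℝ :=
  (shiftSeq z.1, z.2 * φ (z.1 0))

/-- The average of the two copies of `μ` on the levels `1` and `ε`. -/
def twoLevel {A : Type*} [MeasurableSpace A] (μ : Measure (ℕ → A)) (ε : ℝ) :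
    Measure ((ℕ → A) × ℝ) :=
  (2 : ENNReal)⁻¹ • (Measure.map (fun x => (x, (1 : ℝ))) μ + Measure.map (fun x => (x, ε)) μ)

section Skew

variable {A : Type*} [MeasurableSpace A] [MeasurableSingletonClass A]
  {μ : Measure (ℕ → A)} {φ : A → ℝ} {ε : ℝ} {w : A → ENNReal}

omit [MeasurableSingletonClass A] in
lemma twoLevel_apply {B : Set ((ℕ → A) × ℝ)} (hB : MeasurableSet B) :
    twoLevel μ ε B = 2⁻¹ * (μ {x | (x, (1 : ℝ)) ∈ B} + μ {x | (x, ε) ∈ B}) := by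
  rw [twoLevel, Measure.smul_apply, Measure.add_apply,
    Measure.map_apply measurable_prodMk_right hB, Measure.map_apply measurable_prodMk_right hB]
  rfl

instance [IsProbabilityMeasure μ] : IsProbabilityMeasure (twoLevel μ ε) := ⟨by
  rw [twoLevel_apply MeasurableSet.univ]
  simp only [Set.mem_univ, Set.ofPred_true, measure_univ]
  rw [one_add_one_eq_two, ENNReal.inv_mul_cancel] <;> simp⟩

omit [MeasurableSingletonClass A] in
lemma ae_twoLevel_of_ae {p : (ℕ → A) × ℝ → Prop} (h1 : ∀ᵐ x ∂μ, p (x, 1))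
    (h2 : ∀ᵐ x ∂μ, p (x, ε)) (hp : MeasurableSet {z | p z}) : ∀ᵐ z ∂(twoLevel μ ε), p z := by
  rw [ae_iff] at h1 h2 ⊢
  have : {z | ¬ p z} = {z | p z}ᶜ := rfl
  rw [this, twoLevel_apply hp.compl]
  have e1 : μ {x | (x, (1 : ℝ)) ∈ {z | p z}ᶜ} = 0 := h1
  have e2 : μ {x | (x, ε) ∈ {z | p z}ᶜ} = 0 := h2
  rw [e1, e2]
  simp

omit [MeasurableSingletonClass A] in
lemma ae_of_ae_twoLevel {p : (ℕ → A) × ℝ → Prop} (h : ∀ᵐ z ∂(twoLevel μ ε), p z) :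
    ∀ᵐ x ∂μ, p (x, 1) := by
  rw [twoLevel] at h
  have h' : ∀ᵐ z ∂(Measure.map (fun x => (x, (1 : ℝ))) μ + Measure.map (fun x => (x, ε)) μ), p z := by
    rw [ae_iff] at h ⊢
    rw [Measure.smul_apply, smul_eq_mul, mul_eq_zero] at h
    exact h.resolve_left (by simp)
  exact ae_of_ae_map (f := fun x : ℕ → A => (x, (1 : ℝ))) measurable_prodMk_right.aemeasurable
    (ae_add_measure_iff.1 h').1

variable [Fintype A]

lemma measurable_skewShift : Measurable (skewShift φ : (ℕ → A) × ℝ → (ℕ → A) × ℝ) :=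
  (measurable_shiftSeq.comp measurable_fst).prodMk
    (measurable_snd.mul ((measurable_of_countable φ).comp
      ((measurable_pi_apply 0).comp measurable_fst)))

lemma measure_eq_sum_first (μ : Measure (ℕ → A)) (E : Set (ℕ → A)) :
    μ E = ∑ a, μ ({x | x 0 = a} ∩ E) := by
  have h := sum_measure_preimage_singleton (μ := μ.restrict E) (f := fun x : ℕ → A => x 0)
    Finset.univ fun a _ => measurableSet_coord_eq 0 a
  rw [Finset.coe_univ, Set.preimage_univ, Measure.restrict_apply_univ] at h
  rw [← h]
  exact Finset.sum_congr rfl fun a _ => (Measure.restrict_apply (measurableSet_coord_eq 0 a))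

lemma measure_skewShift_section
    (hμ : ∀ a E, MeasurableSet E → μ ({x | x 0 = a} ∩ shiftSeq ⁻¹' E) = w a * μ E)
    {B : Set ((ℕ → A) × ℝ)} (hB : MeasurableSet B) (s : ℝ) :
    μ {x | (x, s) ∈ skewShift φ ⁻¹' B} = ∑ a, w a * μ {x | (x, s * φ a) ∈ B} := by
  rw [measure_eq_sum_first μ]
  refine Finset.sum_congr rfl fun a _ => ?_
  have h := hμ a {x | (x, s * φ a) ∈ B} (measurable_prodMk_right hB)
  rw [← h]
  congr 1
  ext x
  simp only [Set.mem_inter_iff, Set.mem_ofPred_eq, Set.mem_preimage, skewShift]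
  constructor
  · rintro ⟨h, h'⟩
    exact ⟨h, by rwa [h] at h'⟩
  · rintro ⟨h, h'⟩
    exact ⟨h, by rwa [h]⟩

lemma measurePreserving_skewShift [IsProbabilityMeasure μ]
    (hμ : ∀ a E, MeasurableSet E → μ ({x | x 0 = a} ∩ shiftSeq ⁻¹' E) = w a * μ E)
    (hφ : ∀ a, φ a = 1 ∨ φ a = ε) (hε : ε * ε = 1) :
    MeasurePreserving (skewShift φ) (twoLevel μ ε) (twoLevel μ ε) := by
  have hw : ∑ a, w a = 1 := by
    have h := measure_eq_sum_first μ Set.univ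
    rw [measure_univ] at h
    rw [h]
    refine Finset.sum_congr rfl fun a _ => ?_
    have := hμ a Set.univ MeasurableSet.univ
    rw [measure_univ, mul_one] at this
    exact this.symm
  refine ⟨measurable_skewShift, ?_⟩
  ext B hB
  rw [Measure.map_apply measurable_skewShift hB, twoLevel_apply (measurable_skewShift hB),
    twoLevel_apply hB, measure_skewShift_section hμ hB, measure_skewShift_section hμ hB,
    ← Finset.sum_add_distrib]
  congr 1
  rw [← one_mul (_ + _), ← hw, Finset.sum_mul]
  refine Finset.sum_congr rfl fun a _ => ?_
  rcases hφ a with h | h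
  · simp only [h, mul_one, mul_add]
  · simp only [h, one_mul, hε, mul_add]
    rw [add_comm]

/-- A skew product over a Bernoulli shift with values in a group of order at most two is ergodic as
soon as the cocycle generates the group. -/
lemma ergodic_skewShift [Nonempty A] [IsProbabilityMeasure μ]
    (hμ : ∀ a E, MeasurableSet E → μ ({x | x 0 = a} ∩ shiftSeq ⁻¹' E) = w a * μ E)
    (hφ : ∀ a, φ a = 1 ∨ φ a = ε) (hε : ε * ε = 1)
    (hgen : ε = 1 ∨ ∃ a, φ a = ε ∧ w a ≠ 0) :
    Ergodic (skewShift φ) (twoLevel μ ε) := by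
  have hcyl1 : ∀ (n : ℕ) (c : ℕ → A), μ (seqCylinder (n + 1) c)
      = w (c 0) * μ (seqCylinder n (shiftSeq c)) := fun n c => by
    rw [seqCylinder_succ, hμ _ _ (measurableSet_seqCylinder _ _)]
  have hwa : ∀ a, w a = μ {x | x 0 = a} := fun a => by
    have := hμ a Set.univ MeasurableSet.univ
    rw [measure_univ, mul_one] at this
    rw [← this, Set.preimage_univ, Set.inter_univ]
  have hw : ∑ a, w a = 1 := by
    have h := measure_eq_sum_first μ Set.univ
    rw [measure_univ] at h
    rw [h]
    exact Finset.sum_congr rfl fun a _ => by rw [hwa, Set.inter_univ]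
  have hwtop : ∀ a, w a ≠ ⊤ := fun a => by rw [hwa]; exact measure_ne_top _ _
  refine ⟨measurePreserving_skewShift hμ hφ hε, ⟨fun B hB hinv => ?_⟩⟩
  have hBs : ∀ s : ℝ, MeasurableSet {x : ℕ → A | (x, s) ∈ B} := fun s =>
    (measurable_prodMk_right hB : MeasurableSet {x : ℕ → A | (x, s) ∈ B})
  have hlev : μ {x | (x, ε) ∈ B} = μ {x | (x, (1 : ℝ)) ∈ B} := by
    rcases hgen with h | ⟨a₀, ha₀, hw₀⟩
    · rw [h]
    have h1 := measure_skewShift_section (φ := φ) hμ hB 1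
    rw [hinv] at h1
    simp only [one_mul] at h1
    have h2 := congrArg ENNReal.toReal h1
    rw [ENNReal.toReal_sum (fun a _ => ENNReal.mul_ne_top (hwtop a) (measure_ne_top _ _))] at h2
    have h3 := congrArg ENNReal.toReal hw
    rw [ENNReal.toReal_sum (fun a _ => hwtop a)] at h3
    simp only [ENNReal.toReal_mul, ENNReal.toReal_one] at h2 h3
    set x := (μ {x | (x, (1 : ℝ)) ∈ B}).toReal with hx
    set y := (μ {x | (x, ε) ∈ B}).toReal with hy
    by_contra hne
    have hxy : y - x ≠ 0 := fun h0 => hne <|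
      (ENNReal.toReal_eq_toReal_iff' (measure_ne_top _ _) (measure_ne_top _ _)).1 (sub_eq_zero.1 h0)
    have hval : ∀ a, (μ {x | (x, φ a) ∈ B}).toReal = x ∨ (μ {x | (x, φ a) ∈ B}).toReal = y :=
      fun a => by rcases hφ a with h | h <;> simp [h, hx, hy]
    have h4 : ∑ a, (w a).toReal * (((μ {x | (x, φ a) ∈ B}).toReal - x) / (y - x)) = 0 := by
      have : ∀ a, (w a).toReal * (((μ {x | (x, φ a) ∈ B}).toReal - x) / (y - x))
          = ((w a).toReal * (μ {x | (x, φ a) ∈ B}).toReal - (w a).toReal * x) / (y - x) :=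
        fun a => by ring
      rw [Finset.sum_congr rfl fun a _ => this a, ← Finset.sum_div, Finset.sum_sub_distrib,
        ← h2, ← Finset.sum_mul, h3]
      simp
    have h5 := (Finset.sum_eq_zero_iff_of_nonneg fun a _ => mul_nonneg ENNReal.toReal_nonneg (by
      rcases hval a with h | h <;> rw [h]
      · simp
      · rw [div_self hxy]; exact zero_le_one)).1 h4 a₀ (Finset.mem_univ _)
    rw [ha₀, ← hy, div_self hxy, mul_one, ENNReal.toReal_eq_zero_iff] at h5
    exact h5.elim hw₀ (hwtop a₀)
  have hlev' : ∀ s, s = 1 ∨ s = ε → μ {x | (x, s) ∈ B} = μ {x | (x, (1 : ℝ)) ∈ B} := by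
    rintro s (rfl | rfl)
    · rfl
    · exact hlev
  have hind : ∀ (n : ℕ) (c : ℕ → A) (s : ℝ), s = 1 ∨ s = ε →
      μ ({x | (x, s) ∈ B} ∩ seqCylinder n c)
        = μ {x | (x, (1 : ℝ)) ∈ B} * μ (seqCylinder n c) := by
    intro n
    induction n with
    | zero =>
      intro c s hs
      simp [hlev' s hs]
    | succ n ih =>
      intro c s hs
      have hs' : s * φ (c 0) = 1 ∨ s * φ (c 0) = ε := by
        rcases hs with rfl | rfl <;> rcases hφ (c 0) with h | h <;> simp [h, hε]
      have e : {x | (x, s) ∈ B} ∩ seqCylinder (n + 1) c = {x | x 0 = c 0} ∩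
          shiftSeq ⁻¹' ({x | (x, s * φ (c 0)) ∈ B} ∩ seqCylinder n (shiftSeq c)) := by
        rw [seqCylinder_succ]
        ext x
        have hx : (x, s) ∈ B ↔ (shiftSeq x, s * φ (x 0)) ∈ B := by
          conv_lhs => rw [← hinv]
          rfl
        simp only [Set.mem_inter_iff, Set.mem_ofPred_eq, Set.mem_preimage, hx]
        constructor
        · rintro ⟨h1, h2, h3⟩
          rw [h2] at h1
          exact ⟨h2, h1, h3⟩
        · rintro ⟨h2, h1, h3⟩
          rw [h2]
          exact ⟨h1, rfl, h3⟩
      rw [e, hμ _ _ ((hBs _).inter (measurableSet_seqCylinder _ _)), ih _ _ hs', hcyl1]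
      ring
  have hmeas : μ.restrict {x | (x, (1 : ℝ)) ∈ B} = μ {x | (x, (1 : ℝ)) ∈ B} • μ := by
    refine Measure.ext_of_seqCylinder fun n c => ?_
    rw [Measure.restrict_apply (measurableSet_seqCylinder n c), Set.inter_comm,
      hind n c 1 (Or.inl rfl), Measure.smul_apply, smul_eq_mul]
  have hidem := congrArg (fun ν : Measure (ℕ → A) => ν {x | (x, (1 : ℝ)) ∈ B}) hmeas
  simp only [Measure.smul_apply, smul_eq_mul, Measure.restrict_apply (hBs 1), Set.inter_self]
    at hidem
  have h01 : μ {x | (x, (1 : ℝ)) ∈ B} = 0 ∨ μ {x | (x, (1 : ℝ)) ∈ B} = 1 := by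
    by_cases h0 : μ {x | (x, (1 : ℝ)) ∈ B} = 0
    · exact Or.inl h0
    · right
      have := (ENNReal.mul_eq_left h0 (measure_ne_top _ _)).1 hidem.symm
      exact this
  have htot : twoLevel μ ε B = μ {x | (x, (1 : ℝ)) ∈ B} := by
    rw [twoLevel_apply hB, hlev, ← two_mul, ← mul_assoc, ENNReal.inv_mul_cancel, one_mul] <;> simp
  rw [eventuallyConst_set']
  rcases h01 with h | h
  · left
    exact ae_eq_empty.2 (htot.trans h)
  · right
    rw [eventuallyEq_univ]
    exact (prob_compl_eq_zero_iff hB).2 (htot.trans h)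

end Skew

/-- The point with address `x` in the attractor of the maps `y ↦ r a * y + t a`. -/
def code {A : Type*} (r t : A → ℝ) (x : ℕ → A) : ℝ :=
  ∑' n : ℕ, (∏ j ∈ Finset.range n, r (x j)) * t (x n)

section Code

variable {A : Type*} [Finite A] {r t : A → ℝ}

lemma exists_summable_code_bound (hr : ∀ a, |r a| < 1) : ∃ u : ℕ → ℝ, Summable u ∧
    ∀ (x : ℕ → A) n, ‖(∏ j ∈ Finset.range n, r (x j)) * t (x n)‖ ≤ u n := by
  cases nonempty_fintype A
  rcases isEmpty_or_nonempty A with h | h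
  · exact ⟨0, summable_zero, fun x => (h.false (x 0)).elim⟩
  obtain ⟨a₀, h₀⟩ := Finite.exists_max fun a => |r a|
  obtain ⟨a₁, h₁⟩ := Finite.exists_max fun a => |t a|
  refine ⟨fun n => |r a₀| ^ n * |t a₁|,
    (summable_geometric_of_lt_one (abs_nonneg _) (hr a₀)).mul_right _, fun x n => ?_⟩
  rw [norm_mul, norm_prod, Real.norm_eq_abs]
  refine mul_le_mul ?_ (h₁ _) (abs_nonneg _) (by positivity)
  calc ∏ j ∈ Finset.range n, ‖r (x j)‖ ≤ ∏ _j ∈ Finset.range n, |r a₀| :=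
        Finset.prod_le_prod (fun _ _ => norm_nonneg _) fun j _ => h₀ (x j)
    _ = |r a₀| ^ n := by simp

lemma continuous_code [TopologicalSpace A] [DiscreteTopology A] (hr : ∀ a, |r a| < 1) :
    Continuous (code r t) := by
  obtain ⟨u, hu, hb⟩ := exists_summable_code_bound (t := t) hr
  refine continuous_tsum (fun n => ?_) hu fun n x => hb x n
  refine Continuous.mul (continuous_finsetProd _ fun j _ => ?_) ?_
  · exact (continuous_of_discreteTopology (f := r)).comp (continuous_apply j)
  · exact (continuous_of_discreteTopology (f := t)).comp (continuous_apply n)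

lemma measurable_code [MeasurableSpace A] [MeasurableSingletonClass A] (hr : ∀ a, |r a| < 1) :
    Measurable (code r t) := by
  let _ : TopologicalSpace A := ⊥
  have : DiscreteTopology A := ⟨rfl⟩
  exact (continuous_code hr).measurable

lemma code_eq (hr : ∀ a, |r a| < 1) (x : ℕ → A) :
    code r t x = r (x 0) * code r t (shiftSeq x) + t (x 0) := by
  obtain ⟨u, hu, hb⟩ := exists_summable_code_bound (t := t) hr
  rw [code, (Summable.of_norm_bounded hu (hb x)).tsum_eq_zero_add, code, ← tsum_mul_left, add_comm]
  congr 1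
  · refine tsum_congr fun n => ?_
    rw [Finset.prod_range_succ', shiftSeq]
    simp only [shiftSeq]
    ring
  · simp

/-- Addresses over the same point of the base that start with different letters code points which
are uniformly separated. -/
lemma exists_code_gap {I : Type*} {π : A → I} (hr : ∀ a, |r a| < 1)
    (hsep : ∀ x y : ℕ → A, (∀ n, π (x n) = π (y n)) → x 0 ≠ y 0 → code r t x ≠ code r t y) :
    ∃ δ > 0, ∀ x y : ℕ → A, (∀ n, π (x n) = π (y n)) → x 0 ≠ y 0 →
      δ ≤ |code r t x - code r t y| := by
  let _ : TopologicalSpace A := ⊥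
  have : DiscreteTopology A := ⟨rfl⟩
  set D : Set ((ℕ → A) × (ℕ → A)) := {z | (∀ n, π (z.1 n) = π (z.2 n)) ∧ z.1 0 ≠ z.2 0} with hD
  have hDc : IsCompact D := by
    refine IsClosed.isCompact ?_
    have e : D = (⋂ n, (fun z : (ℕ → A) × (ℕ → A) => (z.1 n, z.2 n)) ⁻¹'
        {c : A × A | π c.1 = π c.2}) ∩
        (fun z : (ℕ → A) × (ℕ → A) => (z.1 0, z.2 0)) ⁻¹' {c : A × A | c.1 ≠ c.2} := by
      ext z; simp [hD]
    rw [e]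
    exact (isClosed_iInter fun n => (isClosed_discrete _).preimage (by fun_prop)).inter
      ((isClosed_discrete _).preimage (by fun_prop))
  rcases D.eq_empty_or_nonempty with h | h
  · refine ⟨1, one_pos, fun x y h1 h2 => ?_⟩
    have : (x, y) ∈ D := ⟨h1, h2⟩
    rw [h] at this
    exact this.elim
  · obtain ⟨z, hz, hmin⟩ := hDc.exists_isMinOn h
      (f := fun z => |code r t z.1 - code r t z.2|)
      (((continuous_code hr).comp continuous_fst).sub
        ((continuous_code hr).comp continuous_snd)).abs.continuousOn
    refine ⟨_, abs_pos.2 (sub_ne_zero.2 (hsep z.1 z.2 hz.1 hz.2)), fun x y h1 h2 => ?_⟩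
    exact hmin (a := (x, y)) ⟨h1, h2⟩

lemma eq_of_code_eq {I : Type*} {π : A → I} (hr : ∀ a, |r a| < 1) (hr0 : ∀ a, r a ≠ 0)
    (hsep : ∀ x y : ℕ → A, (∀ n, π (x n) = π (y n)) → x 0 ≠ y 0 → code r t x ≠ code r t y)
    {x y : ℕ → A} (hxy : ∀ n, π (x n) = π (y n)) (h : code r t x = code r t y) : x = y := by
  funext n
  induction n generalizing x y with
  | zero => exact not_not.1 fun h0 => hsep x y hxy h0 h
  | succ n ih =>
    have h0 : x 0 = y 0 := not_not.1 fun h0 => hsep x y hxy h0 h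
    rw [code_eq hr x, code_eq hr y, h0, add_left_inj, mul_right_inj' (hr0 _)] at h
    exact ih (fun m => hxy (m + 1)) h

end Code

/-- A family of probability measures `κ ω` on the sequences `x` lying over `ω`, compatible with the
shift. -/
structure IsFiberSystem {A I : Type*} [MeasurableSpace A] (π : A → I) (w : A → ENNReal)
    (κ : (ℕ → I) → Measure (ℕ → A)) : Prop where
  prob : ∀ ω, IsProbabilityMeasure (κ ω)
  fiber : ∀ ω, ∀ᵐ x ∂κ ω, ∀ n, π (x n) = ω n
  shift : ∀ ω a, π a = ω 0 → ∀ E, MeasurableSet E →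
    κ ω ({x | x 0 = a} ∩ shiftSeq ⁻¹' E) = w a * κ (shiftSeq ω) E

/-- Close to the point coded by `x`, the projection of `κ ω` is an affine copy of the projection of
`κ (shiftSeq ω)`. -/
lemma IsFiberSystem.map_code_apply {A I : Type*} [Finite A] [MeasurableSpace A]
    [MeasurableSingletonClass A] {π : A → I} {w : A → ENNReal} {κ : (ℕ → I) → Measure (ℕ → A)}
    (hκ : IsFiberSystem π w κ) {r t : A → ℝ} (hr : ∀ a, |r a| < 1) {δ : ℝ}
    (hδ : ∀ x y : ℕ → A, (∀ n, π (x n) = π (y n)) → x 0 ≠ y 0 →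
      δ ≤ |code r t x - code r t y|) (x : ℕ → A) {E : Set ℝ} (hE : MeasurableSet E)
    (hEδ : ∀ y ∈ E, |code r t x - y| < δ) :
    Measure.map (code r t) (κ (π ∘ x)) E = w (x 0) *
      Measure.map (code r t) (κ (π ∘ shiftSeq x)) ((fun y => r (x 0) * y + t (x 0)) ⁻¹' E) := by
  have hm : Measurable (fun y => r (x 0) * y + t (x 0)) := by fun_prop
  rw [Measure.map_apply (measurable_code hr) hE, Measure.map_apply (measurable_code hr) (hm hE)]
  have e := hκ.shift (π ∘ x) (x 0) rfl _ ((measurable_code (t := t) hr) (hm hE))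
  have e' : shiftSeq (π ∘ x) = π ∘ shiftSeq x := rfl
  rw [← e', ← e]
  refine measure_congr ?_
  filter_upwards [hκ.fiber (π ∘ x)] with y hy
  apply propext
  change code r t y ∈ E ↔ y 0 = x 0 ∧ r (x 0) * code r t (shiftSeq y) + t (x 0) ∈ E
  constructor
  · intro h
    have h0 : y 0 = x 0 := by
      by_contra h0
      exact absurd (hEδ _ h) (not_lt.2 (hδ x y (fun n => (hy n).symm) fun h => h0 h.symm))
    refine ⟨h0, ?_⟩
    rwa [← h0, ← code_eq hr]
  · rintro ⟨h0, h⟩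
    rwa [code_eq hr y, h0]

/-- The normalized restriction of `η` to the ball of radius `exp (-t)` around `x`, rescaled to
`[-1, 1]` and reflected if `s = -1`. -/
def blowUp (η : Measure ℝ) (x t s : ℝ) : Measure ℝ :=
  (η {y | |y - x| ≤ Real.exp (-t)})⁻¹ •
    (Measure.map (fun y => s * Real.exp t * (y - x)) η).restrict (Set.Icc (-1 : ℝ) 1)

section BlowUp

variable {η : Measure ℝ} {x t s : ℝ}

lemma exp_mul_abs_le_one_iff {t u v : ℝ} :
    Real.exp t * |u| ≤ Real.exp (-v) ↔ |u| ≤ Real.exp (-(t + v)) := by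
  rw [neg_add, Real.exp_add, Real.exp_neg t, inv_mul_eq_div, le_div_iff₀ (Real.exp_pos t), mul_comm]

lemma abs_scale_le_one_iff (hs : |s| = 1) {y : ℝ} :
    s * Real.exp t * (y - x) ∈ Set.Icc (-1 : ℝ) 1 ↔ |y - x| ≤ Real.exp (-t) := by
  have h := exp_mul_abs_le_one_iff (t := t) (u := y - x) (v := 0)
  rw [neg_zero, Real.exp_zero, add_zero] at h
  rw [Set.mem_Icc, ← abs_le, abs_mul, abs_mul, hs, one_mul, Real.abs_exp, h]

lemma blowUp_apply {E : Set ℝ} (hE : MeasurableSet E) :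
    blowUp η x t s E = (η {y | |y - x| ≤ Real.exp (-t)})⁻¹ *
      η {y | s * Real.exp t * (y - x) ∈ E ∩ Set.Icc (-1 : ℝ) 1} := by
  rw [blowUp, Measure.smul_apply, Measure.restrict_apply hE, Measure.map_apply (by fun_prop)
    (hE.inter measurableSet_Icc)]
  rfl

lemma blowUp_univ (hs : |s| = 1) : blowUp η x t s Set.univ =
    (η {y | |y - x| ≤ Real.exp (-t)})⁻¹ * η {y | |y - x| ≤ Real.exp (-t)} := by
  rw [blowUp_apply MeasurableSet.univ, Set.univ_inter]
  simp only [abs_scale_le_one_iff hs]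

lemma isProbabilityMeasure_blowUp [IsFiniteMeasure η] (hs : |s| = 1)
    (h0 : η {y | |y - x| ≤ Real.exp (-t)} ≠ 0) : IsProbabilityMeasure (blowUp η x t s) :=
  ⟨by rw [blowUp_univ hs, ENNReal.inv_mul_cancel h0 (measure_ne_top _ _)]⟩

lemma recenter_eq_blowUp : recenter η x = blowUp η x 0 1 := by
  have : Set.Icc (x - 1) (x + 1) = {y | |y - x| ≤ Real.exp (-0)} := by
    ext y
    rw [Set.mem_Icc, Set.mem_ofPred_eq, neg_zero, Real.exp_zero, abs_le]
    constructor <;> rintro ⟨h1, h2⟩ <;> constructor <;> linarith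
  rw [recenter, blowUp, this]
  simp

lemma scaleM_blowUp [IsFiniteMeasure η] (hs : |s| = 1)
    (h0 : η {y | |y - x| ≤ Real.exp (-t)} ≠ 0) {τ : ℝ} (hτ : 0 ≤ τ) :
    scaleM τ (blowUp η x t s) = blowUp η x (t + τ) s := by
  have hτ1 : Real.exp (-τ) ≤ 1 := by simpa using hτ
  have h1 : blowUp η x t s (Set.Icc (-(Real.exp (-τ))) (Real.exp (-τ)))
      = (η {y | |y - x| ≤ Real.exp (-t)})⁻¹ * η {y | |y - x| ≤ Real.exp (-(t + τ))} := by
    rw [blowUp_apply measurableSet_Icc, Set.inter_eq_left.2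
      (Set.Icc_subset_Icc (neg_le_neg hτ1) hτ1)]
    simp only [Set.mem_Icc, ← abs_le, abs_mul, hs, one_mul, Real.abs_exp, exp_mul_abs_le_one_iff]
  have hc : (η {y | |y - x| ≤ Real.exp (-t)})⁻¹ ≠ 0 := ENNReal.inv_ne_zero.2 (measure_ne_top _ _)
  have hc' : (η {y | |y - x| ≤ Real.exp (-t)})⁻¹ ≠ ⊤ := ENNReal.inv_ne_top.2 h0
  ext E hE
  have hm : Measurable fun y : ℝ => Real.exp τ * y := by fun_prop
  rw [scaleM, Measure.smul_apply, Measure.restrict_apply hE,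
    Measure.map_apply hm (hE.inter measurableSet_Icc), h1,
    blowUp_apply (hm (hE.inter measurableSet_Icc)), blowUp_apply hE, smul_eq_mul,
    ENNReal.mul_inv (Or.inl hc) (Or.inl hc'), mul_mul_mul_comm,
    ENNReal.inv_mul_cancel hc hc', one_mul]
  congr 2
  ext y
  simp only [Set.mem_inter_iff, Set.mem_preimage, Set.mem_ofPred_eq]
  have e : Real.exp τ * (s * Real.exp t * (y - x)) = s * Real.exp (t + τ) * (y - x) := by
    rw [Real.exp_add]; ring
  rw [e, and_iff_left_of_imp]
  rintro ⟨-, h⟩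
  rw [abs_scale_le_one_iff hs] at h ⊢
  refine h.trans (Real.exp_le_exp.2 ?_)
  linarith

lemma blowUp_singleton_zero (hs : |s| = 1) (h : η {x} = 0) : blowUp η x t s {0} = 0 := by
  rw [blowUp_apply (measurableSet_singleton 0)]
  have hs0 : s ≠ 0 := by rintro rfl; simp at hs
  have : {y | s * Real.exp t * (y - x) ∈ ({0} : Set ℝ) ∩ Set.Icc (-1 : ℝ) 1} ⊆ {x} := by
    rintro y ⟨h1, -⟩
    have := (mul_eq_zero.1 (Set.mem_singleton_iff.1 h1)).resolve_left
      (mul_ne_zero hs0 (Real.exp_pos t).ne')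
    exact sub_eq_zero.1 this
  rw [measure_mono_null this h, mul_zero]

/-- If `η` is near `x` an affine copy of `η'` near `x'`, then the blow-ups agree up to a change of
scale and orientation. -/
lemma blowUp_eq_of_affine {η' : Measure ℝ} {x' c d : ℝ} {w : ENNReal} (hw0 : w ≠ 0) (hw : w ≠ ⊤)
    (hc : c ≠ 0) (hs : |s| = 1) (hx : x = c * x' + d)
    (h : ∀ E, MeasurableSet E → (∀ y ∈ E, |y - x| ≤ Real.exp (-t)) →
      η E = w * η' ((fun y => c * y + d) ⁻¹' E)) :
    blowUp η x t s = blowUp η' x' (t + Real.log |c|) (s * (c / |c|)) := by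
  have hca : 0 < |c| := abs_pos.2 hc
  have hexp : Real.exp (t + Real.log |c|) = Real.exp t * |c| := by
    rw [Real.exp_add, Real.exp_log hca]
  have hs' : |s * (c / |c|)| = 1 := by
    rw [abs_mul, hs, abs_div, abs_abs, div_self hca.ne', one_mul]
  have hy : ∀ y, c * y + d - x = c * (y - x') := fun y => by rw [hx]; ring
  have hball : η {y | |y - x| ≤ Real.exp (-t)}
      = w * η' {y | |y - x'| ≤ Real.exp (-(t + Real.log |c|))} := by
    rw [h {y | |y - x| ≤ Real.exp (-t)}
      (measurableSet_le (by fun_prop : Measurable fun y : ℝ => |y - x|) measurable_const)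
      fun y hy => hy]
    congr 2
    ext y
    simp only [Set.mem_preimage, Set.mem_ofPred_eq]
    rw [hy, abs_mul, Real.exp_neg (t + Real.log |c|), hexp, mul_inv, ← Real.exp_neg,
      ← div_eq_mul_inv, le_div_iff₀ hca, mul_comm]
  ext E hE
  rw [blowUp_apply hE, blowUp_apply hE, hball, h]
  · rw [ENNReal.mul_inv (Or.inl hw0) (Or.inl hw), mul_mul_mul_comm, ENNReal.inv_mul_cancel hw0 hw,
      one_mul]
    congr 2
    ext y
    simp only [Set.mem_preimage, Set.mem_ofPred_eq]
    have : s * Real.exp t * (c * y + d - x)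
        = s * (c / |c|) * Real.exp (t + Real.log |c|) * (y - x') := by
      rw [hy, hexp]; field_simp
    rw [this]
  · exact (by fun_prop : Measurable fun y => s * Real.exp t * (y - x))
      (hE.inter measurableSet_Icc)
  · rintro y ⟨-, h⟩
    exact (abs_scale_le_one_iff hs).1 h

end BlowUp

lemma toProb_coe {ν : Measure ℝ} (h : IsProbabilityMeasure ν) : (toProb ν : Measure ℝ) = ν := by
  have : toProb ν = (⟨ν, h⟩ : ProbabilityMeasure ℝ) := dif_pos h
  rw [this]
  rfl

lemma toProb_apply {ν : Measure ℝ} (E : Set ℝ) [Decidable (ν Set.univ = 1)] :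
    (toProb ν : Measure ℝ) E = if ν Set.univ = 1 then ν E else Measure.dirac 0 E := by
  split_ifs with h
  · rw [toProb_coe ⟨h⟩]
  · have : toProb ν = (⟨Measure.dirac 0, inferInstance⟩ : ProbabilityMeasure ℝ) :=
      dif_neg fun h' : IsProbabilityMeasure ν => h h'.measure_univ
    rw [this]
    rfl

lemma scaleFlow_toProb_blowUp {η : Measure ℝ} [IsFiniteMeasure η] {x t s τ : ℝ} (hs : |s| = 1)
    (h0 : η {y | |y - x| ≤ Real.exp (-t)} ≠ 0) (hτ : 0 ≤ τ) :
    scaleFlow τ (toProb (blowUp η x t s)) = toProb (blowUp η x (t + τ) s) := by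
  rw [scaleFlow, toProb_coe (isProbabilityMeasure_blowUp hs h0), scaleM_blowUp hs h0 hτ]

/-- The probability measures on the line that live on `[-1, 1]`. -/
def probIcc : Set (ProbabilityMeasure ℝ) := {ν | (ν : Measure ℝ) (Set.Icc (-1 : ℝ) 1)ᶜ = 0}

lemma isCompact_probIcc : IsCompact probIcc := by
  have h := isCompact_setOfPred_probabilityMeasure_mass_eq_compl_isCompact_le (E := ℝ) (u := 0)
    (K := fun _ => Set.Icc (-1 : ℝ) 1) tendsto_const_nhds (fun _ => isCompact_Icc)
    (Or.inl inferInstance)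
  convert h using 1
  ext ν
  simp only [probIcc, Set.mem_ofPred_eq, Pi.zero_apply, nonpos_iff_eq_zero, forall_const]
  exact (ProbabilityMeasure.null_iff_toMeasure_null ν _).symm

lemma measurableSet_probIcc : MeasurableSet probIcc := isCompact_probIcc.isClosed.measurableSet

instance : CompactSpace probIcc := isCompact_iff_compactSpace.1 isCompact_probIcc

lemma measurable_toMeasure : Measurable fun ν : ProbabilityMeasure ℝ => (ν : Measure ℝ) := by
  refine Measurable.measure_of_isPiSystem_of_isProbabilityMeasure
    ((BorelSpace.measurable_eq (α := ℝ)).trans borel_eq_generateFrom_isClosed) isPiSystem_isClosed ?_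
  intro s hs
  refine measurable_of_tendsto_metrizable (f := fun n (ν : ProbabilityMeasure ℝ) =>
    ∫⁻ x, IsClosed.apprSeq hs n x ∂(ν : Measure ℝ)) (fun n => ?_) ?_
  · exact (ProbabilityMeasure.continuous_lintegral_boundedContinuousFunction _).measurable
  · rw [tendsto_pi_nhds]
    exact fun ν => HasOuterApproxClosed.tendsto_lintegral_apprSeq hs _

lemma measurable_toMeasure_apply {E : Set ℝ} (hE : MeasurableSet E) :
    Measurable fun ν : ProbabilityMeasure ℝ => (ν : Measure ℝ) E :=
  (Measure.measurable_coe hE).comp measurable_toMeasure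

/-- The topology on a space of probability measures is generated by the integrals of the
continuous functions. -/
lemma probIcc_eq_generateFrom : (instTopologicalSpaceSubtype : TopologicalSpace probIcc)
    = TopologicalSpace.generateFrom {s | ∃ (f : BoundedContinuousFunction ℝ NNReal)
      (U : Set ENNReal), IsOpen U ∧
        s = (fun ν : probIcc => ∫⁻ x, f x ∂((ν : ProbabilityMeasure ℝ) : Measure ℝ)) ⁻¹' U} := by
  apply le_antisymm
  · refine le_generateFrom ?_
    rintro _ ⟨f, U, hU, rfl⟩
    exact hU.preimage ((ProbabilityMeasure.continuous_lintegral_boundedContinuousFunction f).comp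
      continuous_subtype_val)
  · have key : ∀ (X : Type) [TopologicalSpace X] (g : X → probIcc),
        (∀ f : BoundedContinuousFunction ℝ NNReal, Continuous fun a =>
          ∫⁻ x, f x ∂((g a : ProbabilityMeasure ℝ) : Measure ℝ)) → Continuous g :=
      fun X _ g hg => continuous_induced_rng.2
        (ProbabilityMeasure.continuous_iff_forall_continuous_lintegral.2 hg)
    rw [← continuous_id_iff_le]
    refine @key probIcc (TopologicalSpace.generateFrom _) id fun f => ?_
    refine continuous_def.2 fun U hU => TopologicalSpace.isOpen_generateFrom_of_mem ?_
    exact ⟨f, U, hU, rfl⟩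

lemma measurable_of_measurable_apply {α : Type*} [MeasurableSpace α] {g : α → ProbabilityMeasure ℝ}
    (hg : ∀ a, g a ∈ probIcc)
    (h : ∀ E, MeasurableSet E → Measurable fun a => (g a : Measure ℝ) E) : Measurable g := by
  let g' : α → probIcc := fun a => ⟨g a, hg a⟩
  suffices Measurable g' from measurable_subtype_coe.comp this
  have hm : Measurable fun a => (g a : Measure ℝ) := Measure.measurable_of_measurable_coe _ h
  have e := borel_eq_generateFrom_of_subbasis probIcc_eq_generateFrom
  rw [← BorelSpace.measurable_eq] at e
  rw [e]
  refine measurable_generateFrom ?_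
  rintro _ ⟨f, U, hU, rfl⟩
  have := (Measure.measurable_lintegral (f := fun x => (f x : ENNReal)) (by fun_prop)).comp hm
  exact this hU.measurableSet

lemma toProb_mem_probIcc {m : Measure ℝ} (hm : m (Set.Icc (-1 : ℝ) 1)ᶜ = 0) :
    toProb m ∈ probIcc := by
  classical
  change (toProb m : Measure ℝ) _ = 0
  rw [toProb_apply]
  split_ifs
  · exact hm
  · simp

lemma measurable_toProb {α : Type*} [MeasurableSpace α] {m : α → Measure ℝ}
    (hm : ∀ a, m a (Set.Icc (-1 : ℝ) 1)ᶜ = 0) (h : ∀ E, MeasurableSet E → Measurable fun a => m a E) :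
    Measurable fun a => toProb (m a) := by
  classical
  refine measurable_of_measurable_apply (fun a => toProb_mem_probIcc (hm a)) fun E hE => ?_
  simp only [toProb_apply]
  exact Measurable.ite (h _ MeasurableSet.univ (measurableSet_singleton 1)) (h E hE)
    measurable_const

lemma blowUp_compl_Icc {η : Measure ℝ} {x t s : ℝ} : blowUp η x t s (Set.Icc (-1 : ℝ) 1)ᶜ = 0 := by
  rw [blowUp, Measure.smul_apply, Measure.restrict_apply measurableSet_Icc.compl,
    Set.compl_inter_self, measure_empty, smul_zero]

lemma measurable_scaleFlow (τ : ℝ) : Measurable (scaleFlow τ) := by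
  refine measurable_toProb (fun ν => ?_) fun E hE => ?_
  · rw [scaleM, Measure.smul_apply, Measure.restrict_apply measurableSet_Icc.compl,
      Set.compl_inter_self, measure_empty, smul_zero]
  · have hm : Measurable fun y : ℝ => Real.exp τ * y := by fun_prop
    simp only [scaleM, Measure.smul_apply, Measure.restrict_apply hE,
      Measure.map_apply hm (hE.inter measurableSet_Icc), smul_eq_mul]
    exact (measurable_toMeasure_apply measurableSet_Icc).inv.mul
      (measurable_toMeasure_apply (hm (hE.inter measurableSet_Icc)))

/-- Countably many bounded Borel functions suffice to approximate all continuous functions uniformly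
on `probIcc`. -/
lemma exists_seq_approx_probIcc : ∃ h : ℕ → ProbabilityMeasure ℝ → ℝ,
    (∀ n, Measurable (h n)) ∧ (∀ n, ∃ M, ∀ ν, |h n ν| ≤ M) ∧
    ∀ f : C(ProbabilityMeasure ℝ, ℝ), ∀ ε > 0, ∃ n, ∀ ν ∈ probIcc, |f ν - h n ν| ≤ ε := by
  have hemb : MeasurableEmbedding (Subtype.val : probIcc → ProbabilityMeasure ℝ) :=
    MeasurableEmbedding.subtype_coe measurableSet_probIcc
  refine ⟨fun n => Function.extend Subtype.val (TopologicalSpace.denseSeq C(probIcc, ℝ) n) 0,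
    fun n => ?_, fun n => ?_, fun f ε hε => ?_⟩
  · exact hemb.measurable_extend (ContinuousMap.continuous _).measurable measurable_zero
  · refine ⟨‖TopologicalSpace.denseSeq C(probIcc, ℝ) n‖, fun ν => ?_⟩
    beta_reduce
    by_cases hν : ν ∈ probIcc
    · rw [show ν = ((⟨ν, hν⟩ : probIcc) : ProbabilityMeasure ℝ) from rfl,
        Subtype.val_injective.extend_apply]
      exact (TopologicalSpace.denseSeq C(probIcc, ℝ) n).norm_coe_le_norm _
    · rw [Function.extend_apply' _ _ _ (fun ⟨ν', h⟩ => hν (h ▸ ν'.2))]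
      simp
  · obtain ⟨n, hn⟩ := (TopologicalSpace.denseRange_denseSeq C(probIcc, ℝ)).exists_dist_lt
      (f.restrict probIcc) hε
    refine ⟨n, fun ν hν => ?_⟩
    have e : ν = ((⟨ν, hν⟩ : probIcc) : ProbabilityMeasure ℝ) := rfl
    beta_reduce
    rw [e, Subtype.val_injective.extend_apply]
    have := (ContinuousMap.dist_apply_le_dist (f := f.restrict probIcc)
      (g := TopologicalSpace.denseSeq C(probIcc, ℝ) n) ⟨ν, hν⟩).trans hn.le
    rwa [Real.dist_eq] at this

lemma measurable_measure_section {α : Type*} [MeasurableSpace α] {η : α → Measure ℝ}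
    (hη : Measurable η) (hprob : ∀ a, IsProbabilityMeasure (η a)) {B : Set (α × ℝ)}
    (hB : MeasurableSet B) : Measurable fun a => η a {y | (a, y) ∈ B} := by
  let K : ProbabilityTheory.Kernel α ℝ := ⟨η, hη⟩
  have : ProbabilityTheory.IsMarkovKernel K := ⟨hprob⟩
  exact ProbabilityTheory.Kernel.measurable_kernel_prodMk_left (κ := K) hB

lemma measurable_measure_ball {α : Type*} [MeasurableSpace α] {η : α → Measure ℝ}
    (hη : Measurable η) (hprob : ∀ a, IsProbabilityMeasure (η a)) {x R : α → ℝ} (hx : Measurable x)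
    (hR : Measurable R) : Measurable fun a => η a {y | |y - x a| ≤ R a} :=
  measurable_measure_section hη hprob (B := {b | |b.2 - x b.1| ≤ R b.1})
    (measurableSet_le (by fun_prop : Measurable fun b : α × ℝ => |b.2 - x b.1|) (by fun_prop))

lemma measurable_toProb_blowUp {α : Type*} [MeasurableSpace α] {η : α → Measure ℝ}
    (hη : Measurable η) (hprob : ∀ a, IsProbabilityMeasure (η a)) {x t s : α → ℝ}
    (hx : Measurable x) (ht : Measurable t) (hs : Measurable s) :
    Measurable fun a => toProb (blowUp (η a) (x a) (t a) (s a)) := by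
  refine measurable_toProb (fun a => blowUp_compl_Icc) fun E hE => ?_
  simp only [blowUp_apply hE]
  refine (measurable_measure_ball hη hprob hx (by fun_prop)).inv.mul ?_
  exact measurable_measure_section hη hprob
    (B := {b | s b.1 * Real.exp (t b.1) * (b.2 - x b.1) ∈ E ∩ Set.Icc (-1 : ℝ) 1})
    ((by fun_prop : Measurable fun b : α × ℝ => s b.1 * Real.exp (t b.1) * (b.2 - x b.1))
      (hE.inter measurableSet_Icc))

lemma ae_measure_ball_ne_zero (η : Measure ℝ) :
    ∀ᵐ x ∂η, ∀ n : ℕ, η {y | |y - x| ≤ 1 / ((n : ℝ) + 1)} ≠ 0 := by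
  filter_upwards [Measure.support_mem_ae (μ := η)] with x hx n
  refine ((Measure.mem_support_iff_forall x).1 hx _ ?_).ne'
  have : {y | |y - x| ≤ 1 / ((n : ℝ) + 1)} = Metric.closedBall x (1 / ((n : ℝ) + 1)) := by
    ext y; simp [Real.dist_eq]
  rw [this]
  exact Metric.closedBall_mem_nhds x (by positivity)

lemma measure_ball_ne_zero_of_forall_nat {η : Measure ℝ} {x : ℝ}
    (h : ∀ n : ℕ, η {y | |y - x| ≤ 1 / ((n : ℝ) + 1)} ≠ 0) {R : ℝ} (hR : 0 < R) :
    η {y | |y - x| ≤ R} ≠ 0 := by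
  obtain ⟨n, hn⟩ := exists_nat_one_div_lt hR
  exact fun h0 => h n (measure_mono_null (fun y hy => le_trans hy hn.le) h0)

lemma ae_suspMeas_of_forall {Z Y : Type*} [MeasurableSpace Z] [MeasurableSpace Y] {m : Measure Z}
    {ρ : Z → ℝ} {F : Z × ℝ → Y} (hF : Measurable F) {p : Y → Prop} (hp : MeasurableSet {y | p y})
    (h : ∀ z, p (F z)) : ∀ᵐ y ∂(suspMeas m ρ F), p y := by
  rw [suspMeas]
  exact Measure.ae_smul_measure ((ae_map_iff hF.aemeasurable hp).2 (Eventually.of_forall h)) _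

/-- Convergence of time averages for a countable family of test functions that approximates all
continuous functions uniformly on `probIcc` gives convergence for all continuous functions. -/
lemma tendsto_average_of_approx {Q : Measure (ProbabilityMeasure ℝ)} [IsProbabilityMeasure Q]
    (hQ : ∀ᵐ ν ∂Q, ν ∈ probIcc) {h : ℕ → ProbabilityMeasure ℝ → ℝ}
    (hm : ∀ n, Measurable (h n)) (hb : ∀ n, ∃ M, ∀ ν, |h n ν| ≤ M)
    {g : ℝ → ProbabilityMeasure ℝ} (hg : Measurable g) (hgK : ∀ t, g t ∈ probIcc)
    (hlim : ∀ n, Tendsto (fun R : ℝ => R⁻¹ * ∫ t in (0 : ℝ)..R, h n (g t)) atTop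
      (𝓝 (∫ ν, h n ν ∂Q)))
    {f : C(ProbabilityMeasure ℝ, ℝ)} (hf : ∀ ε > 0, ∃ n, ∀ ν ∈ probIcc, |f ν - h n ν| ≤ ε) :
    Tendsto (fun R : ℝ => R⁻¹ * ∫ t in (0 : ℝ)..R, f (g t)) atTop (𝓝 (∫ ν, f ν ∂Q)) := by
  obtain ⟨M, hM⟩ := isCompact_probIcc.exists_bound_of_continuousOn f.continuous.continuousOn
  have hfi : Integrable f Q := by
    refine Integrable.of_bound f.continuous.measurable.aestronglyMeasurable M ?_
    filter_upwards [hQ] with ν hν using hM ν hν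
  have hfg : ∀ u v, IntervalIntegrable (fun t => f (g t)) volume u v :=
    intervalIntegrable_of_abs_le (f.continuous.measurable.comp hg)
    (fun t => hM _ (hgK t))
  rw [Metric.tendsto_atTop]
  intro ε hε
  obtain ⟨n, hn⟩ := hf (ε / 4) (by positivity)
  obtain ⟨N, hN⟩ := (Metric.tendsto_atTop.1 (hlim n)) (ε / 4) (by positivity)
  obtain ⟨M', hM'⟩ := hb n
  have hhg : ∀ u v, IntervalIntegrable (fun t => h n (g t)) volume u v :=
    intervalIntegrable_of_abs_le ((hm n).comp hg) (fun t => hM' (g t))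
  refine ⟨max N 1, fun R hR => ?_⟩
  have hR0 : 0 < R := lt_of_lt_of_le one_pos ((le_max_right _ _).trans hR)
  have h1 : |R⁻¹ * (∫ t in (0 : ℝ)..R, f (g t)) - R⁻¹ * ∫ t in (0 : ℝ)..R, h n (g t)| ≤ ε / 4 := by
    rw [← mul_sub, ← intervalIntegral.integral_sub (hfg 0 R) (hhg 0 R), abs_mul,
      abs_of_pos (inv_pos.2 hR0), inv_mul_le_iff₀ hR0, mul_comm]
    refine (intervalIntegral.norm_integral_le_of_norm_le_const (C := ε / 4)
      (f := fun t => f (g t) - h n (g t)) fun t _ => hn _ (hgK t)).trans ?_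
    rw [sub_zero, abs_of_pos hR0]
  have h2 := hN R ((le_max_left _ _).trans hR)
  have h3 : |(∫ ν, f ν ∂Q) - ∫ ν, h n ν ∂Q| ≤ ε / 4 := by
    rw [← integral_sub hfi (integrable_of_abs_le (hm n) hM')]
    have := norm_integral_le_of_norm_le_const (μ := Q) (C := ε / 4)
      (f := fun ν => f ν - h n ν) (by filter_upwards [hQ] with ν hν using hn ν hν)
    simpa using this
  rw [Real.dist_eq] at h2 ⊢
  rw [abs_le] at h1 h3
  rw [abs_lt] at h2 ⊢
  constructor <;> linarith

section Scenery

variable {A I : Type*} [Fintype A] [Nonempty A] [MeasurableSpace A] [MeasurableSingletonClass A]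
  [MeasurableSpace I] {π : A → I} {w : A → ENNReal} {κ : (ℕ → I) → Measure (ℕ → A)}
  {r t : A → ℝ} {μ : Measure (ℕ → A)} {P : Measure (ℕ → I)}

/-- The projection to the line of the measure on the fibre through `x`. -/
def fiberProj (π : A → I) (κ : (ℕ → I) → Measure (ℕ → A)) (r t : A → ℝ) (x : ℕ → A) : Measure ℝ :=
  Measure.map (code r t) (κ (π ∘ x))

/-- The scenery at time `τ` of the projected fibre measure at the point coded by `z.1`, with
orientation `z.2`. -/
def scenery (π : A → I) (κ : (ℕ → I) → Measure (ℕ → A)) (r t : A → ℝ) (z : (ℕ → A) × ℝ) (τ : ℝ) :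
    ProbabilityMeasure ℝ :=
  toProb (blowUp (fiberProj π κ r t z.1) (code r t z.1) τ z.2)

omit [Nonempty A] [MeasurableSpace I] in
lemma isProbabilityMeasure_fiberProj (hκ : IsFiberSystem π w κ) (hr : ∀ a, |r a| < 1)
    (x : ℕ → A) : IsProbabilityMeasure (fiberProj π κ r t x) :=
  have := hκ.prob (π ∘ x)
  Measure.isProbabilityMeasure_map (measurable_code hr).aemeasurable

omit [Nonempty A] in
lemma measurable_fiberProj (hκm : Measurable κ) (hr : ∀ a, |r a| < 1) :
    Measurable (fiberProj π κ r t) :=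
  (Measure.measurable_map _ (measurable_code hr)).comp (hκm.comp
    (measurable_pi_lambda _ fun n => (measurable_of_countable π).comp (measurable_pi_apply n)))

omit [Nonempty A] in
lemma measurable_scenery (hκ : IsFiberSystem π w κ) (hκm : Measurable κ) (hr : ∀ a, |r a| < 1) :
    Measurable fun z : ((ℕ → A) × ℝ) × ℝ => scenery π κ r t z.1 z.2 :=
  measurable_toProb_blowUp
    (η := fun z : ((ℕ → A) × ℝ) × ℝ => fiberProj π κ r t z.1.1)
    (x := fun z : ((ℕ → A) × ℝ) × ℝ => code r t z.1.1)
    ((measurable_fiberProj hκm hr).comp (measurable_fst.comp measurable_fst))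
    (fun z => isProbabilityMeasure_fiberProj hκ hr z.1.1)
    ((measurable_code hr).comp (measurable_fst.comp measurable_fst)) measurable_snd
    (measurable_snd.comp measurable_fst)

omit [Nonempty A] in
lemma measurable_scenery_add (hκ : IsFiberSystem π w κ) (hκm : Measurable κ) (hr : ∀ a, |r a| < 1)
    (C : ℝ) : Measurable fun z : ((ℕ → A) × ℝ) × ℝ => scenery π κ r t z.1 (z.2 + C) := by
  have hshift : Measurable fun z : ((ℕ → A) × ℝ) × ℝ => (z.1, z.2 + C) :=
    measurable_fst.prodMk (measurable_snd.add_const C)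
  have h := (measurable_scenery (r := r) (t := t) hκ hκm hr).comp hshift
  exact h

omit [Fintype A] [Nonempty A] [MeasurableSingletonClass A] [MeasurableSpace I] in
lemma scenery_mem_probIcc (z : (ℕ → A) × ℝ) (τ : ℝ) : scenery π κ r t z τ ∈ probIcc :=
  toProb_mem_probIcc blowUp_compl_Icc

omit [Nonempty A] [MeasurableSpace I] in
lemma scenery_skewShift (hκ : IsFiberSystem π w κ) (hw0 : ∀ a, w a ≠ 0) (hw : ∀ a, w a ≠ ⊤)
    (hr : ∀ a, |r a| < 1) (hr0 : ∀ a, r a ≠ 0) {δ : ℝ}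
    (hδ : ∀ x y : ℕ → A, (∀ n, π (x n) = π (y n)) → x 0 ≠ y 0 →
      δ ≤ |code r t x - code r t y|) {z : (ℕ → A) × ℝ} (hz : |z.2| = 1) {τ : ℝ}
    (hτ : Real.exp (-τ) < δ) :
    scenery π κ r t z τ
      = scenery π κ r t (skewShift (fun a => r a / |r a|) z) (τ + Real.log |r (z.1 0)|) := by
  rw [scenery, scenery, skewShift]
  congr 1
  refine blowUp_eq_of_affine (hw0 (z.1 0)) (hw _) (hr0 _) hz (code_eq hr z.1) fun E hE h => ?_
  refine hκ.map_code_apply hr hδ z.1 hE fun y hy => ?_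
  rw [abs_sub_comm]
  exact (h y hy).trans_lt hτ

omit [Nonempty A] in
lemma ae_bind_fiberProj_ball_ne_zero (hκ : IsFiberSystem π w κ) (hκm : Measurable κ)
    (hr : ∀ a, |r a| < 1) : ∀ᵐ x ∂(P.bind κ), ∀ n : ℕ,
      fiberProj π κ r t x {y | |y - code r t x| ≤ 1 / ((n : ℝ) + 1)} ≠ 0 := by
  have hset : MeasurableSet {x : ℕ → A | ∀ n : ℕ,
      fiberProj π κ r t x {y | |y - code r t x| ≤ 1 / ((n : ℝ) + 1)} ≠ 0} := by
    rw [show {x : ℕ → A | ∀ n : ℕ,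
      fiberProj π κ r t x {y | |y - code r t x| ≤ 1 / ((n : ℝ) + 1)} ≠ 0} = ⋂ n : ℕ, {x : ℕ → A |
      fiberProj π κ r t x {y | |y - code r t x| ≤ 1 / ((n : ℝ) + 1)} ≠ 0} by ext; simp]
    refine MeasurableSet.iInter fun n => ?_
    exact (measurable_measure_ball (measurable_fiberProj hκm hr)
      (isProbabilityMeasure_fiberProj hκ hr) (measurable_code hr) measurable_const)
      (measurableSet_singleton 0).compl
  rw [ae_iff, ← Set.compl_ofPred, Measure.bind_apply hset.compl hκm.aemeasurable]
  refine lintegral_eq_zero_of_ae_eq_zero (Eventually.of_forall fun ω => ?_)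
  change ∀ᵐ x ∂κ ω, ∀ n : ℕ,
      fiberProj π κ r t x {y | |y - code r t x| ≤ 1 / ((n : ℝ) + 1)} ≠ 0
  have h := ae_of_ae_map (measurable_code hr).aemeasurable
    (ae_measure_ball_ne_zero (Measure.map (code r t) (κ ω)))
  filter_upwards [hκ.fiber ω, h] with x hx hx'
  rw [fiberProj, show π ∘ x = ω from funext hx]
  exact hx'

omit [Fintype A] [Nonempty A] [MeasurableSingletonClass A] in
lemma ae_twoLevel_fst {ε : ℝ} {p : (ℕ → A) → Prop} (h : ∀ᵐ x ∂μ, p x) :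
    ∀ᵐ z ∂(twoLevel μ ε), p z.1 := by
  have hmap : Measure.map Prod.fst (twoLevel μ ε) = μ := by
    ext E hE
    rw [Measure.map_apply measurable_fst hE, twoLevel_apply (measurable_fst hE)]
    change 2⁻¹ * (μ E + μ E) = μ E
    rw [← two_mul, ← mul_assoc, ENNReal.inv_mul_cancel (by simp) (by simp), one_mul]
  exact ae_of_ae_map measurable_fst.aemeasurable (hmap.symm ▸ h)

/-- The sceneries of the fibre measures generate an ergodic distribution invariant under the scaling
flow. -/
lemma exists_scenery_distribution [IsProbabilityMeasure μ] (hκ : IsFiberSystem π w κ)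
    (hκm : Measurable κ) (hμκ : μ = P.bind κ) {v : A → ENNReal} (hv0 : ∀ a, v a ≠ 0)
    (hμ : ∀ a E, MeasurableSet E → μ ({x | x 0 = a} ∩ shiftSeq ⁻¹' E) = v a * μ E)
    (hw0 : ∀ a, w a ≠ 0) (hw : ∀ a, w a ≠ ⊤) (hr : ∀ a, |r a| < 1) (hr0 : ∀ a, r a ≠ 0)
    (hsep : ∀ x y : ℕ → A, (∀ n, π (x n) = π (y n)) → x 0 ≠ y 0 → code r t x ≠ code r t y)
    (hatom : ∀ᵐ x ∂μ, ∀ y, fiberProj π κ r t x {y} = 0) :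
    ∃ Q : Measure (ProbabilityMeasure ℝ), IsProbabilityMeasure Q ∧
      (∀ τ : ℝ, 0 ≤ τ → Measure.map (scaleFlow τ) Q = Q) ∧
      (∀ E : Set (ProbabilityMeasure ℝ), MeasurableSet E →
        (∀ τ : ℝ, 0 ≤ τ → Q (symmDiff E ((scaleFlow τ) ⁻¹' E)) = 0) → Q E = 0 ∨ Q E = 1) ∧
      Q ≠ Measure.dirac (toProb (Measure.dirac 0)) ∧
      (∀ᵐ x ∂μ, ∀ f : C(ProbabilityMeasure ℝ, ℝ),
        Tendsto (fun R : ℝ => R⁻¹ * ∫ τ in (0 : ℝ)..R, f (scenery π κ r t (x, 1) τ)) atTop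
          (𝓝 (∫ ν, f ν ∂Q))) := by
  obtain ⟨δ, hδ0, hδ⟩ := exists_code_gap hr hsep
  obtain ⟨C, hCδ⟩ : ∃ C : ℝ, Real.exp (-C) < δ :=
    ((Real.tendsto_exp_neg_atTop_nhds_zero).eventually_lt_const hδ0).exists
  obtain ⟨ε, hε, hφ, hgen⟩ : ∃ ε : ℝ, |ε| = 1 ∧ (∀ a, r a / |r a| = 1 ∨ r a / |r a| = ε) ∧
      (ε = 1 ∨ ∃ a, r a / |r a| = ε) := by
    by_cases h : ∀ a, 0 < r a
    · exact ⟨1, abs_one, fun a => Or.inl (by rw [abs_of_pos (h a), div_self (hr0 a)]), Or.inl rfl⟩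
    · push Not at h
      obtain ⟨a, ha⟩ := h
      have hneg : ∀ a, r a < 0 → r a / |r a| = -1 := fun a ha => by
        rw [abs_of_neg ha, div_neg, div_self ha.ne]
      refine ⟨-1, by simp, fun b => ?_, Or.inr ⟨a, hneg a (lt_of_le_of_ne ha (hr0 a))⟩⟩
      rcases lt_or_gt_of_ne (hr0 b) with hb | hb
      · exact Or.inr (hneg b hb)
      · exact Or.inl (by rw [abs_of_pos hb, div_self (hr0 b)])
  have hεε : ε * ε = 1 := by rw [← abs_mul_abs_self, hε, one_mul]
  have hT : Ergodic (skewShift fun a => r a / |r a|) (twoLevel μ ε) :=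
    ergodic_skewShift hμ hφ hεε (hgen.imp_right fun ⟨a, ha⟩ => ⟨a, ha, hv0 a⟩)
  -- the roof function
  obtain ⟨a₀, ha₀⟩ := Finite.exists_min fun a => -Real.log |r a|
  obtain ⟨a₁, ha₁⟩ := Finite.exists_max fun a => -Real.log |r a|
  set ρ : (ℕ → A) × ℝ → ℝ := fun z => -Real.log |r (z.1 0)| with hρdef
  have hρ : Measurable ρ := (measurable_of_countable fun a => -Real.log |r a|).comp
    ((measurable_pi_apply 0).comp measurable_fst)
  have ha : 0 < -Real.log |r a₀| := neg_pos.2 (Real.log_neg (abs_pos.2 (hr0 a₀)) (hr a₀))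
  have hρa : ∀ z, -Real.log |r a₀| ≤ ρ z := fun z => ha₀ (z.1 0)
  have hρb : ∀ z, ρ z ≤ -Real.log |r a₁| := fun z => ha₁ (z.1 0)
  -- the flow lines
  obtain ⟨F, hFdef⟩ : ∃ F : ((ℕ → A) × ℝ) × ℝ → ProbabilityMeasure ℝ,
    F = fun z => scenery π κ r t z.1 (z.2 + C) := ⟨_, rfl⟩
  have hF : Measurable F := hFdef ▸ measurable_scenery_add hκ hκm hr C
  have hFK : ∀ z, F z ∈ probIcc := fun z => by
    rw [hFdef]
    exact scenery_mem_probIcc z.1 (z.2 + C)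
  have hone : ∀ᵐ z ∂(twoLevel μ ε), |z.2| = 1 :=
    ae_twoLevel_of_ae (p := fun z => |z.2| = 1) (by simp) (by simp [hε])
      ((by fun_prop : Measurable fun z : (ℕ → A) × ℝ => |z.2|) (measurableSet_singleton 1))
  have hball : ∀ᵐ z ∂(twoLevel μ ε), ∀ n : ℕ,
      fiberProj π κ r t z.1 {y | |y - code r t z.1| ≤ 1 / ((n : ℝ) + 1)} ≠ 0 := by
    exact ae_twoLevel_fst (hμκ ▸ ae_bind_fiberProj_ball_ne_zero hκ hκm hr)
  have hFT : ∀ᵐ z ∂(twoLevel μ ε), ∀ τ, 0 ≤ τ →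
      F (z, ρ z + τ) = F (skewShift (fun a => r a / |r a|) z, τ) := by
    filter_upwards [hone] with z hz τ hτ
    simp only [hFdef]
    rw [scenery_skewShift hκ hw0 hw hr hr0 hδ hz]
    · congr 1
      simp only [hρdef]
      ring
    · refine lt_of_le_of_lt (Real.exp_le_exp.2 ?_) hCδ
      have := (ha.trans_le (hρa z))
      linarith
  have hSF : ∀ᵐ z ∂(twoLevel μ ε), ∀ τ σ, 0 ≤ τ → 0 ≤ σ →
      scaleFlow σ (F (z, τ)) = F (z, τ + σ) := by
    filter_upwards [hone, hball] with z hz hzb τ σ _ hσ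
    have := isProbabilityMeasure_fiberProj (t := t) hκ hr z.1
    simp only [hFdef, scenery]
    rw [scaleFlow_toProb_blowUp hz (measure_ball_ne_zero_of_forall_nat hzb (Real.exp_pos _)) hσ]
    congr 2
    ring
  have hQ := isProbabilityMeasure_suspMeas (m := twoLevel μ ε) hρ ha hρa hρb hF
  refine ⟨suspMeas (twoLevel μ ε) ρ F, hQ,
    fun τ hτ => map_suspMeas hT.toMeasurePreserving hρ ha hρa hρb hF hFT measurable_scaleFlow hSF hτ,
    fun E hE hinv => suspMeas_eq_zero_or_one hT hρ ha hρa hρb hF hFT hSF hE hinv, fun heq => ?_, ?_⟩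
  · have hh : Measurable fun ν : ProbabilityMeasure ℝ => (ν : Measure ℝ).real {0} :=
      (measurable_toMeasure_apply (measurableSet_singleton 0)).ennreal_toReal
    have hint := integral_suspMeas (m := twoLevel μ ε) hρ ha hρa hρb hF hh (M := 1) fun ν => by
      rw [abs_of_nonneg measureReal_nonneg]
      exact measureReal_le_one
    have hzero : ∀ᵐ z ∂(twoLevel μ ε),
        (∫ τ in (0 : ℝ)..ρ z, ((F (z, τ) : ProbabilityMeasure ℝ) : Measure ℝ).real {0}) = 0 := by
      have hat : ∀ᵐ z ∂(twoLevel μ ε), fiberProj π κ r t z.1 {code r t z.1} = 0 :=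
        ae_twoLevel_fst (hatom.mono fun x hx => hx _)
      filter_upwards [hone, hball, hat] with z hz hzb hza
      refine intervalIntegral.integral_zero_ae (Eventually.of_forall fun τ _ => ?_)
      have := isProbabilityMeasure_fiberProj (t := t) hκ hr z.1
      simp only [hFdef, scenery, Measure.real]
      rw [toProb_coe (isProbabilityMeasure_blowUp hz
        (measure_ball_ne_zero_of_forall_nat hzb (Real.exp_pos _))),
        blowUp_singleton_zero hz hza, ENNReal.toReal_zero]
    rw [integral_eq_zero_of_ae hzero, mul_zero, heq, integral_dirac' _ _ hh.stronglyMeasurable,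
      toProb_coe inferInstance, Measure.real,
      Measure.dirac_apply' _ (measurableSet_singleton 0)] at hint
    simp at hint
  · obtain ⟨h, hm, hb, happ⟩ := exists_seq_approx_probIcc
    have hQK := ae_suspMeas_of_forall (m := twoLevel μ ε) (ρ := ρ) hF measurableSet_probIcc hFK
    have hall : ∀ᵐ z ∂(twoLevel μ ε), ∀ n, Tendsto (fun R : ℝ => R⁻¹ *
        ∫ τ in (0 : ℝ)..R, h n (F (z, τ))) atTop (𝓝 (∫ ν, h n ν ∂(suspMeas (twoLevel μ ε) ρ F))) :=
      ae_all_iff.2 fun n => by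
        obtain ⟨M, hM⟩ := hb n
        exact ae_tendsto_average_suspMeas hT hρ ha hρa hρb hF hFT (hm n) hM
    filter_upwards [ae_of_ae_twoLevel hall] with x hx f
    have hFx : Measurable fun τ => F ((x, 1), τ) := hF.comp measurable_prodMk_left
    have hlim := tendsto_average_of_approx hQK hm hb hFx (fun τ => hFK _) hx (happ f)
    obtain ⟨M, hM⟩ := isCompact_probIcc.exists_bound_of_continuousOn f.continuous.continuousOn
    have := tendsto_average_shift (g := fun τ => f (F ((x, 1), τ))) (c := -C)
      (f.continuous.measurable.comp hFx) (fun τ => hM _ (hFK _)) hlim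
    simpa [hFdef] using this

end Scenery

section FiniteFibers

variable {I : Type*} {k : I → ℕ}

instance Sigma.measurableSingletonClass_fin : MeasurableSingletonClass (Σ i, Fin (k i)) where
  measurableSet_singleton a := by
    refine MeasurableSpace.measurableSet_iInf.2 fun i => ?_
    have h : MeasurableSet (Sigma.mk (β := fun i => Fin (k i)) i ⁻¹' {a}) :=
      (Set.to_countable _).measurableSet
    exact h

/-- Record, along with the letters of `u`, the alphabets they are taken from. -/
def tagSeq (ω : ℕ → I) (u : (n : ℕ) → Fin (k (ω n))) : ℕ → Σ i, Fin (k i) := fun n => ⟨ω n, u n⟩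

lemma measurable_tagSeq (ω : ℕ → I) : Measurable (tagSeq (k := k) ω) :=
  measurable_pi_lambda _ fun n =>
    (measurable_of_countable (Sigma.mk (β := fun i => Fin (k i)) (ω n))).comp (measurable_pi_apply n)

lemma exists_eq_tagSeq {ω : ℕ → I} {x : ℕ → Σ i, Fin (k i)} (h : ∀ n, (x n).1 = ω n) :
    ∃ u, x = tagSeq ω u := by
  obtain rfl : (fun n => (x n).1) = ω := funext h
  exact ⟨fun n => (x n).2, rfl⟩

lemma coding_eq_code (r : I → ℝ) (t : (i : I) → Fin (k i) → ℝ) (ω : ℕ → I) :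
    coding k r t ω = code (fun a : Σ i, Fin (k i) => r a.1) (fun a => t a.1 a.2) ∘ tagSeq ω :=
  rfl

/-- The strong separation condition, in terms of the coding of tagged sequences. -/
lemma code_ne_of_disjoint [Finite I] {r : I → ℝ} (hr : ∀ i, |r i| < 1)
    {t : (i : I) → Fin (k i) → ℝ}
    (hSSC : ∀ ω : ℕ → I, ∀ u v : Fin (k (ω 0)), u ≠ v →
      Disjoint ((fun x => r (ω 0) * x + t (ω 0) u) '' Yset k r t (shiftSeq ω))
               ((fun x => r (ω 0) * x + t (ω 0) v) '' Yset k r t (shiftSeq ω)))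
    (x y : ℕ → Σ i, Fin (k i)) (hxy : ∀ n, (x n).1 = (y n).1) (h0 : x 0 ≠ y 0) :
    code (fun a : Σ i, Fin (k i) => r a.1) (fun a => t a.1 a.2) x
      ≠ code (fun a : Σ i, Fin (k i) => r a.1) (fun a => t a.1 a.2) y := by
  have key : ∀ (ω : ℕ → I) (u v : (n : ℕ) → Fin (k (ω n))), u 0 ≠ v 0 →
      code (fun a : Σ i, Fin (k i) => r a.1) (fun a => t a.1 a.2) (tagSeq ω u)
        ≠ code (fun a : Σ i, Fin (k i) => r a.1) (fun a => t a.1 a.2) (tagSeq ω v) := by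
    intro ω u v huv h
    have hr' : ∀ a : Σ i, Fin (k i), |r a.1| < 1 := fun a => hr a.1
    rw [code_eq hr' (tagSeq ω u), code_eq hr' (tagSeq ω v)] at h
    exact Set.disjoint_left.1 (hSSC ω (u 0) (v 0) huv)
      (Set.mem_image_of_mem _ ⟨fun n => u (n + 1), rfl⟩)
      ⟨_, ⟨fun n => v (n + 1), rfl⟩, h.symm⟩
  obtain ⟨u, rfl⟩ := exists_eq_tagSeq (ω := fun n => (y n).1) hxy
  exact key _ u (fun n => (y n).2) fun h => h0 (congrArg (Sigma.mk _) h)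

/-- The fibre measures transported to tagged sequences. -/
def tagMeas (η' : (ω : ℕ → I) → Measure ((n : ℕ) → Fin (k (ω n)))) (ω : ℕ → I) :
    Measure (ℕ → Σ i, Fin (k i)) :=
  Measure.map (tagSeq ω) (η' ω)

variable {p : (i : I) → Fin (k i) → ℝ} {η' : (ω : ℕ → I) → Measure ((n : ℕ) → Fin (k (ω n)))}

lemma tagMeas_seqCylinder (hk : ∀ i, 0 < k i)
    (hη'cyl : ∀ (ω : ℕ → I) (n : ℕ) (c : (j : ℕ) → Fin (k (ω j))),
      η' ω {u | ∀ j < n, u j = c j} = ∏ j ∈ Finset.range n, ENNReal.ofReal (p (ω j) (c j)))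
    (ω : ℕ → I) (n : ℕ) (c : ℕ → Σ i, Fin (k i)) :
    tagMeas η' ω (seqCylinder n c) = (seqCylinder n fun j => (c j).1).indicator
      (fun _ => ∏ j ∈ Finset.range n, ENNReal.ofReal (p (c j).1 (c j).2)) ω := by
  rw [tagMeas, Measure.map_apply (measurable_tagSeq ω) (measurableSet_seqCylinder n c)]
  by_cases hω : ω ∈ seqCylinder n fun j => (c j).1
  · have hd : ∀ j, ∃ d : Fin (k (ω j)), j < n → (⟨ω j, d⟩ : Σ i, Fin (k i)) = c j := fun j => by
      by_cases hj : j < n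
      · have := hω j hj
        generalize ω j = i at this ⊢
        subst this
        exact ⟨(c j).2, fun _ => rfl⟩
      · exact ⟨⟨0, hk _⟩, fun h => (hj h).elim⟩
    choose d hd using hd
    have hset : tagSeq ω ⁻¹' (seqCylinder n c) = {u | ∀ j < n, u j = d j} := by
      ext u
      refine forall₂_congr fun j hj => ?_
      rw [← hd j hj]
      exact ⟨fun h => eq_of_heq (Sigma.mk.inj_iff.1 h).2, fun h => by rw [tagSeq, h]⟩
    rw [hset, hη'cyl, Set.indicator_of_mem hω]
    exact Finset.prod_congr rfl fun j hj => congrArg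
      (fun a : Σ i, Fin (k i) => ENNReal.ofReal (p a.1 a.2)) (hd j (Finset.mem_range.1 hj))
  · rw [Set.indicator_of_notMem hω, show tagSeq ω ⁻¹' (seqCylinder n c) = ∅ from ?_, measure_empty]
    exact Set.eq_empty_of_forall_notMem fun u hu => hω fun j hj => congrArg Sigma.fst (hu j hj)

lemma isFiberSystem_tagMeas [Finite I] [Nonempty I] [MeasurableSpace I] (hk : ∀ i, 0 < k i)
    (hprob : ∀ ω, IsProbabilityMeasure (η' ω))
    (hη'cyl : ∀ (ω : ℕ → I) (n : ℕ) (c : (j : ℕ) → Fin (k (ω j))),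
      η' ω {u | ∀ j < n, u j = c j} = ∏ j ∈ Finset.range n, ENNReal.ofReal (p (ω j) (c j))) :
    IsFiberSystem Sigma.fst (fun a : Σ i, Fin (k i) => ENNReal.ofReal (p a.1 a.2))
      (tagMeas η') where
  prob ω := Measure.isProbabilityMeasure_map (measurable_tagSeq ω).aemeasurable
  fiber ω := by
    have hm : ∀ n, MeasurableSet {x : ℕ → Σ i, Fin (k i) | (x n).1 = ω n} := fun n =>
      measurable_pi_apply (X := fun _ => Σ i, Fin (k i)) n
        (Set.to_countable {a : Σ i, Fin (k i) | a.1 = ω n}).measurableSet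
    rw [ae_all_iff]
    intro n
    rw [tagMeas, ae_map_iff (measurable_tagSeq ω).aemeasurable (hm n)]
    exact Eventually.of_forall fun u => rfl
  shift ω a ha E hE := by
    have : Nonempty (Σ i, Fin (k i)) := ⟨a⟩
    have hP : IsProbabilityMeasure (tagMeas η' ω) :=
      Measure.isProbabilityMeasure_map (measurable_tagSeq ω).aemeasurable
    refine measure_first_inter_shift (fun n c => ?_) hE
    have hc := seqCylinder_succ n fun j : ℕ => Nat.casesOn (motive := fun _ => Σ i, Fin (k i))
      j a c
    change _ = {x | x 0 = a} ∩ shiftSeq ⁻¹' (seqCylinder n c) at hc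
    rw [← hc, tagMeas_seqCylinder hk hη'cyl, tagMeas_seqCylinder hk hη'cyl]
    have hiff : ω ∈ (seqCylinder (n + 1) fun j : ℕ => (Nat.casesOn
        (motive := fun _ => Σ i, Fin (k i)) j a c : Σ i, Fin (k i)).1)
        ↔ shiftSeq ω ∈ seqCylinder n fun j => (c j).1 := by
      rw [seqCylinder_succ]
      exact and_iff_right ha.symm
    by_cases hω : shiftSeq ω ∈ seqCylinder n fun j => (c j).1
    · rw [Set.indicator_of_mem (hiff.2 hω), Set.indicator_of_mem hω, Finset.prod_range_succ',
        mul_comm]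
      rfl
    · rw [Set.indicator_of_notMem (hiff.not.2 hω), Set.indicator_of_notMem hω, mul_zero]

lemma measurable_tagMeas [Finite I] [Nonempty I] [MeasurableSpace I] [MeasurableSingletonClass I]
    (hk : ∀ i, 0 < k i) (hprob : ∀ ω, IsProbabilityMeasure (η' ω))
    (hη'cyl : ∀ (ω : ℕ → I) (n : ℕ) (c : (j : ℕ) → Fin (k (ω j))),
      η' ω {u | ∀ j < n, u j = c j} = ∏ j ∈ Finset.range n, ENNReal.ofReal (p (ω j) (c j))) :
    Measurable (tagMeas η') := by
  have : Nonempty (Σ i, Fin (k i)) := ⟨⟨Classical.arbitrary I, 0, hk _⟩⟩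
  have := (isFiberSystem_tagMeas hk hprob hη'cyl).prob
  refine measurable_measure_of_seqCylinder fun n c => ?_
  simp only [tagMeas_seqCylinder hk hη'cyl]
  exact measurable_const.indicator (measurableSet_seqCylinder n _)

lemma bind_tagMeas_first_inter_shift [Finite I] [Nonempty I] [MeasurableSpace I]
    [MeasurableSingletonClass I] (hk : ∀ i, 0 < k i) (hprob : ∀ ω, IsProbabilityMeasure (η' ω))
    (hη'cyl : ∀ (ω : ℕ → I) (n : ℕ) (c : (j : ℕ) → Fin (k (ω j))),
      η' ω {u | ∀ j < n, u j = c j} = ∏ j ∈ Finset.range n, ENNReal.ofReal (p (ω j) (c j)))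
    {q : I → ℝ} {P : Measure (ℕ → I)} [IsProbabilityMeasure P]
    (hPcyl : ∀ (n : ℕ) (c : ℕ → I),
      P {ω | ∀ j < n, ω j = c j} = ∏ j ∈ Finset.range n, ENNReal.ofReal (q (c j)))
    (a : Σ i, Fin (k i)) (E : Set (ℕ → Σ i, Fin (k i))) (hE : MeasurableSet E) :
    P.bind (tagMeas η') ({x | x 0 = a} ∩ shiftSeq ⁻¹' E)
      = ENNReal.ofReal (q a.1) * ENNReal.ofReal (p a.1 a.2) * P.bind (tagMeas η') E := by
  have : Nonempty (Σ i, Fin (k i)) := ⟨a⟩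
  have hm := measurable_tagMeas hk hprob hη'cyl
  have := isProbabilityMeasure_bind (m := P) hm.aemeasurable
    (Eventually.of_forall (isFiberSystem_tagMeas hk hprob hη'cyl).prob)
  have hcyl : ∀ (n : ℕ) (c : ℕ → Σ i, Fin (k i)), P.bind (tagMeas η') (seqCylinder n c)
      = ∏ j ∈ Finset.range n, ENNReal.ofReal (q (c j).1) * ENNReal.ofReal (p (c j).1 (c j).2) :=
    fun n c => by
      rw [Measure.bind_apply (measurableSet_seqCylinder n c) hm.aemeasurable]
      simp only [tagMeas_seqCylinder hk hη'cyl]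
      rw [lintegral_indicator (measurableSet_seqCylinder n _), setLIntegral_const, mul_comm,
        Finset.prod_mul_distrib]
      exact congrArg (· * _) (hPcyl n fun j => (c j).1)
  refine measure_first_inter_shift (fun n c => ?_) hE
  have hc := seqCylinder_succ n fun j : ℕ => Nat.casesOn (motive := fun _ => Σ i, Fin (k i)) j a c
  change _ = {x | x 0 = a} ∩ shiftSeq ⁻¹' (seqCylinder n c) at hc
  rw [← hc, hcyl, hcyl, Finset.prod_range_succ', mul_comm]
  rfl

end FiniteFibers

lemma IsFiberSystem.ae_bind_comp {A I : Type*} [MeasurableSpace A] [Finite A]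
    [MeasurableSingletonClass A] [MeasurableSpace I] {π : A → I} {w : A → ENNReal}
    {κ : (ℕ → I) → Measure (ℕ → A)} (hκ : IsFiberSystem π w κ) (hκm : Measurable κ)
    {P : Measure (ℕ → I)} {φ : (ℕ → I) → Prop} (h : ∀ᵐ ω ∂P, φ ω) :
    ∀ᵐ x ∂(P.bind κ), φ (π ∘ x) := by
  have hπ : Measurable fun x : ℕ → A => π ∘ x :=
    measurable_pi_lambda _ fun n => (measurable_of_countable π).comp (measurable_pi_apply n)
  have hac : Measure.map (fun x : ℕ → A => π ∘ x) (P.bind κ) ≪ P := by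
    refine Measure.AbsolutelyContinuous.mk fun E hE h0 => ?_
    rw [Measure.map_apply hπ hE, Measure.bind_apply (hπ hE) hκm.aemeasurable]
    refine lintegral_eq_zero_of_ae_eq_zero ?_
    filter_upwards [measure_eq_zero_iff_ae_notMem.1 h0] with ω hω
    refine measure_eq_zero_iff_ae_notMem.2 ?_
    filter_upwards [hκ.fiber ω] with x hx hxE
    exact hω ((funext hx : π ∘ x = ω) ▸ hxE)
  exact ae_of_ae_map hπ.aemeasurable (hac.ae_le h)

lemma measurableEmbedding_coding {I : Type*} [Finite I] [MeasurableSpace I] {k : I → ℕ}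
    {r : I → ℝ} (hr : ∀ i, |r i| < 1) (hr0 : ∀ i, r i ≠ 0) {t : (i : I) → Fin (k i) → ℝ}
    (hsep : ∀ x y : ℕ → Σ i, Fin (k i), (∀ n, (x n).1 = (y n).1) → x 0 ≠ y 0 →
      code (fun a : Σ i, Fin (k i) => r a.1) (fun a => t a.1 a.2) x
        ≠ code (fun a : Σ i, Fin (k i) => r a.1) (fun a => t a.1 a.2) y) (ω : ℕ → I) :
    MeasurableEmbedding (coding k r t ω) := by
  have hcont : Continuous (coding k r t ω) := by
    have htag : Continuous (tagSeq (k := k) ω) :=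
      continuous_pi fun n => continuous_sigmaMk.comp (continuous_apply n)
    have hcode : Continuous (code (fun a : Σ i, Fin (k i) => r a.1) (fun a => t a.1 a.2)) :=
      continuous_code fun a => hr a.1
    exact hcode.comp htag
  refine (hcont.isClosedEmbedding fun u v huv => ?_).measurableEmbedding
  have := eq_of_code_eq (π := Sigma.fst) (x := tagSeq ω u) (y := tagSeq ω v)
    (fun a : Σ i, Fin (k i) => hr a.1) (fun a => hr0 a.1) hsep (fun _ => rfl) huv
  funext n
  exact eq_of_heq (Sigma.mk.inj_iff.1 (congrFun this n)).2

lemma scaleM_recenter_eq_blowUp {η : Measure ℝ} [IsFiniteMeasure η] {x : ℝ}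
    (h : ∀ n : ℕ, η {y | |y - x| ≤ 1 / ((n : ℝ) + 1)} ≠ 0) {τ : ℝ} (hτ : 0 ≤ τ) :
    scaleM τ (recenter η x) = blowUp η x τ 1 := by
  rw [recenter_eq_blowUp, scaleM_blowUp abs_one
    (measure_ball_ne_zero_of_forall_nat h (Real.exp_pos _)) hτ, zero_add]

/-- for a non-trivial Bernoulli model with strong separation there is a
distribution `Q` on `𝒫([-1,1])` that is `S`-invariant, `S`-ergodic, non-trivial (not the
point mass at `δ₀`), and such that `ℙ`-a.e. measure `η^{(ω)}` generates `Q`. -/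
theorem stmt13
    (I : Type) [Fintype I] [Nonempty I] [MeasurableSpace I] [MeasurableSingletonClass I]
    (k : I → ℕ) (hk : ∀ i, 0 < k i)
    (r : I → ℝ) (hr : ∀ i, |r i| < 1) (hr0 : ∀ i, r i ≠ 0)
    (t : (i : I) → Fin (k i) → ℝ)
    (p : (i : I) → Fin (k i) → ℝ) (hp : ∀ i j, 0 < p i j) (hpsum : ∀ i, ∑ j, p i j = 1)
    (q : I → ℝ) (hq : ∀ i, 0 < q i) (hqsum : ∑ i, q i = 1)
    (P : Measure (ℕ → I)) (hP : IsProbabilityMeasure P)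
    (hPcyl : ∀ (n : ℕ) (c : ℕ → I),
      P {ω | ∀ j < n, ω j = c j} = ∏ j ∈ Finset.range n, ENNReal.ofReal (q (c j)))
    (η' : (ω : ℕ → I) → Measure ((n : ℕ) → Fin (k (ω n))))
    (hη'prob : ∀ ω, IsProbabilityMeasure (η' ω))
    (hη'cyl : ∀ (ω : ℕ → I) (n : ℕ) (c : (j : ℕ) → Fin (k (ω j))),
      η' ω {u | ∀ j < n, u j = c j} = ∏ j ∈ Finset.range n, ENNReal.ofReal (p (ω j) (c j)))
    (hSSC : ∀ ω : ℕ → I, ∀ u v : Fin (k (ω 0)), u ≠ v →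
      Disjoint ((fun x => r (ω 0) * x + t (ω 0) u) '' Yset k r t (shiftSeq ω))
               ((fun x => r (ω 0) * x + t (ω 0) v) '' Yset k r t (shiftSeq ω)))
    (hnontriv : ∀ᵐ ω ∂P, ∀ x : ℝ, etaMeas k r t η' ω {x} = 0) :
    ∃ Q : Measure (ProbabilityMeasure ℝ), IsProbabilityMeasure Q ∧
      -- (a) S-invariance
      (∀ τ : ℝ, 0 ≤ τ → Measure.map (scaleFlow τ) Q = Q) ∧
      -- (b) S-ergodicity
      (∀ A : Set (ProbabilityMeasure ℝ), MeasurableSet A →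
        (∀ τ : ℝ, 0 ≤ τ → Q (symmDiff A ((scaleFlow τ) ⁻¹' A)) = 0) →
        Q A = 0 ∨ Q A = 1) ∧
      -- (c) non-triviality
      Q ≠ Measure.dirac (toProb (Measure.dirac 0)) ∧
      -- (d) ℙ-a.e. η^{(ω)} generates Q
      (∀ᵐ ω ∂P, ∀ᵐ x ∂(etaMeas k r t η' ω), ∀ f : C(ProbabilityMeasure ℝ, ℝ),
        Tendsto (fun T : ℝ =>
            T⁻¹ * ∫ τ in (0:ℝ)..T, f (toProb (scaleM τ (recenter (etaMeas k r t η' ω) x))))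
          atTop (𝓝 (∫ ν, f ν ∂Q))) := by
  have : Nonempty (Σ i, Fin (k i)) := ⟨⟨Classical.arbitrary I, 0, hk _⟩⟩
  have hκ := isFiberSystem_tagMeas hk hη'prob hη'cyl
  have hκm := measurable_tagMeas hk hη'prob hη'cyl
  have hsep := code_ne_of_disjoint hr hSSC
  have hr' : ∀ a : Σ i, Fin (k i), |r a.1| < 1 := fun a => hr a.1
  have hw0 : ∀ a : Σ i, Fin (k i), ENNReal.ofReal (p a.1 a.2) ≠ 0 := fun a =>
    (ENNReal.ofReal_pos.2 (hp _ _)).ne'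
  have heta : ∀ ω, Measure.map (code (fun a : Σ i, Fin (k i) => r a.1) fun a => t a.1 a.2)
      (tagMeas η' ω) = etaMeas k r t η' ω := fun ω => by
    rw [tagMeas, Measure.map_map (measurable_code hr') (measurable_tagSeq ω), etaMeas,
      coding_eq_code]
  have hprob : IsProbabilityMeasure (P.bind (tagMeas η')) :=
    isProbabilityMeasure_bind hκm.aemeasurable (Eventually.of_forall hκ.prob)
  obtain ⟨Q, hQ, hinv, herg, hne, hgen⟩ := exists_scenery_distribution hκ hκm rfl
    (v := fun a => ENNReal.ofReal (q a.1) * ENNReal.ofReal (p a.1 a.2))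
    (fun a => mul_ne_zero (ENNReal.ofReal_pos.2 (hq _)).ne' (hw0 a))
    (bind_tagMeas_first_inter_shift hk hη'prob hη'cyl hPcyl) hw0 (fun a => ENNReal.ofReal_ne_top)
    hr' (fun a => hr0 a.1) hsep
    (hκ.ae_bind_comp hκm (φ := fun ω => ∀ y, Measure.map
      (code (fun a : Σ i, Fin (k i) => r a.1) fun a => t a.1 a.2) (tagMeas η' ω) {y} = 0)
      (by simpa only [heta] using hnontriv))
  refine ⟨Q, hQ, hinv, herg, hne, ?_⟩
  filter_upwards [Measure.ae_ae_of_ae_bind hκm.aemeasurable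
    (hgen.and (ae_bind_fiberProj_ball_ne_zero (t := fun a => t a.1 a.2) hκ hκm hr'))] with ω hω
  rw [etaMeas, (measurableEmbedding_coding hr hr0 hsep ω).ae_map_iff]
  filter_upwards [ae_of_ae_map (measurable_tagSeq ω).aemeasurable hω] with u hu f
  have hfib : fiberProj Sigma.fst (tagMeas η') (fun a : Σ i, Fin (k i) => r a.1)
      (fun a => t a.1 a.2) (tagSeq ω u) = etaMeas k r t η' ω := heta ω
  have hprob' : IsProbabilityMeasure (etaMeas k r t η' ω) :=
    hfib ▸ isProbabilityMeasure_fiberProj hκ hr' _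
  refine (hu.1 f).congr' ?_
  filter_upwards [eventually_ge_atTop 0] with T hT
  congr 1
  refine intervalIntegral.integral_congr fun τ hτ => ?_
  rw [Set.uIcc_of_le hT] at hτ
  have hball := hu.2
  rw [hfib] at hball
  simp only [scenery]
  rw [hfib, ← etaMeas, coding_eq_code, Function.comp_apply, scaleM_recenter_eq_blowUp hball hτ.1]
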